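/- arXiv:1710.04587 — 4 statements merged into one kernel-verified Lean document; each statement's English description precedes it below -/
import Mathlib

section
/- Let n ≥ 2 and let Ω ⊆ ℝ^n be a bounded open convex set with 0 ∈ Ω. Then there exist a constant C > 0 (depending only on Ω) and ε₀ > 0 such that for all 0 < ε < ε₀: 0 ≤ V(Ω) − V(Ω_ε) ≤ C · (P(Ω) − P(Ω_ε)), where Ω_ε is the set obtained from Ω by cutting with a halfspace at distance ε from a farthest boundary point. -/
open MeasureTheory Metric Set Real Bornology

noncomputable section

/-- Volume (Lebesgue measure) of a set in `ℝⁿ`. -/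
def vol (n : ℕ) (Ω : Set (EuclideanSpace ℝ (Fin n))) : ℝ :=
  (volume Ω).toReal

/-- Surface area: the `(n-1)`-dimensional Hausdorff measure of the topological boundary. -/
def perim (n : ℕ) (Ω : Set (EuclideanSpace ℝ (Fin n))) : ℝ :=
  (μH[(n : ℝ) - 1] (frontier Ω)).toReal

/-- Boundary momentum `W(Ω) = ∫_{∂Ω} |x|² dH^{n-1}(x)`. -/
def bmom (n : ℕ) (Ω : Set (EuclideanSpace ℝ (Fin n))) : ℝ :=
  ∫ x in frontier Ω, ‖x‖ ^ 2 ∂μH[(n : ℝ) - 1]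

/-- The scale invariant functional `λ(Ω) = W(Ω) / (P(Ω) V(Ω)^{2/n})`. -/
def lamFun (n : ℕ) (Ω : Set (EuclideanSpace ℝ (Fin n))) : ℝ :=
  bmom n Ω / (perim n Ω * vol n Ω ^ ((2 : ℝ) / n))

/-- `ω_n`: the Lebesgue measure of the unit ball of `ℝⁿ`. -/
def unitBallVol (n : ℕ) : ℝ :=
  (volume (ball (0 : EuclideanSpace ℝ (Fin n)) 1)).toReal

/-- `r_max(Ω) = max {|x| : x ∈ closure Ω}`. -/
def rmax (n : ℕ) (Ω : Set (EuclideanSpace ℝ (Fin n))) : ℝ :=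
  sSup ((fun x => ‖x‖) '' closure Ω)

/-- The Excess `E(Ω) = r_max(Ω) - W(Ω) / (n V(Ω))`. -/
def excess (n : ℕ) (Ω : Set (EuclideanSpace ℝ (Fin n))) : ℝ :=
  rmax n Ω - bmom n Ω / ((n : ℝ) * vol n Ω)

open scoped ENNReal NNReal

/-- A ray from the closure of a bounded set meets the frontier. -/
lemma exists_ray_mem_frontier {E : Type*} [NormedAddCommGroup E] [NormedSpace ℝ E] {Ω : Set E}
    (hbd : IsBounded Ω) {p e : E} (hp : p ∈ closure Ω) (he : e ≠ 0) :
    ∃ τ : ℝ, 0 ≤ τ ∧ p + τ • e ∈ frontier Ω := by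
  have hpre : IsPreconnected ((fun τ : ℝ => p + τ • e) '' Ici 0) :=
    isPreconnected_Ici.image _ (by fun_prop)
  obtain ⟨r, hr⟩ := hbd.closure.exists_norm_le
  have hne : 0 < ‖e‖ := norm_pos_iff.2 he
  have hout : ((fun τ : ℝ => p + τ • e) '' Ici 0 ∩ (closure Ω)ᶜ).Nonempty := by
    have hr0 : 0 ≤ r := (norm_nonneg p).trans (hr p hp)
    refine ⟨_, ⟨(2 * r + 1) / ‖e‖, by simp only [mem_Ici]; positivity, rfl⟩, fun hmem => ?_⟩
    have h1 := hr _ hmem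
    have h2 : ‖((2 * r + 1) / ‖e‖) • e‖ = 2 * r + 1 := by
      rw [norm_smul, Real.norm_of_nonneg (by positivity)]
      field_simp
    have h3 := norm_sub_le (p + ((2 * r + 1) / ‖e‖) • e) p
    rw [add_sub_cancel_left, h2] at h3
    linarith [hr p hp]
  by_contra! hcon
  have hsub : (fun τ : ℝ => p + τ • e) '' Ici 0 ∩ closure Ω ⊆ interior (closure Ω) := by
    rintro _ ⟨⟨τ, hτ, rfl⟩, hq⟩
    by_contra hq'
    exact hcon τ hτ (frontier_closure_subset ⟨subset_closure hq, hq'⟩)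
  obtain ⟨q, -, hq, hq'⟩ := hpre (interior (closure Ω)) (closure Ω)ᶜ isOpen_interior
    isClosed_closure.isOpen_compl
    (fun q hq => (em (q ∈ closure Ω)).imp (fun h => hsub ⟨hq, h⟩) id)
    ⟨p, ⟨0, by simp, by simp⟩, hsub ⟨⟨0, by simp, by simp⟩, hp⟩⟩ hout
  exact hq' (interior_subset hq)

/-- The affine rescaling of the first coordinate multiplies the volume by the scale. -/
lemma volume_image_cons_affine (m : ℕ) (a b : ℝ) (A : Set (Fin (m + 1) → ℝ)) :
    volume ((fun y : Fin (m + 1) → ℝ =>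
      (Fin.cons (a * y 0 + b) (Fin.tail y) : Fin (m + 1) → ℝ)) '' A) =
      ENNReal.ofReal |a| * volume A := by
  set L := Matrix.toLin' (Matrix.diagonal (Fin.cons a 1 : Fin (m + 1) → ℝ))
  have h : (fun y : Fin (m + 1) → ℝ =>
      (Fin.cons (a * y 0 + b) (Fin.tail y) : Fin (m + 1) → ℝ)) =
      (fun y => y + Fin.cons b 0) ∘ L := by
    funext y i
    refine Fin.cases ?_ (fun j => ?_) i
    · simp [L, Matrix.mulVec_diagonal]
    · simp [L, Matrix.mulVec_diagonal, Fin.tail]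
  rw [h, image_comp, image_add_right, measure_preimage_add_right,
    Measure.addHaar_image_linearMap, LinearMap.det_toLin', Matrix.det_diagonal,
    Fin.prod_univ_succ]
  simp

/-- Hausdorff measure on Euclidean space is a positive multiple of Lebesgue measure. -/
lemma exists_hausdorffMeasure_toLp_image (m : ℕ) : ∃ κ : ℝ≥0, 0 < κ ∧
    ∀ A : Set (Fin (m + 1) → ℝ),
      (μH[((m + 1 : ℕ) : ℝ)] : Measure (EuclideanSpace ℝ (Fin (m + 1))))
        (WithLp.toLp 2 '' A) = κ * volume A := by
  have hh : (μH[((m + 1 : ℕ) : ℝ)] : Measure (EuclideanSpace ℝ (Fin (m + 1)))).IsAddHaarMeasure := by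
    have := @MeasureTheory.isAddHaarMeasure_hausdorffMeasure
      (EuclideanSpace ℝ (Fin (m + 1))) _ _ _ _ _
    simpa using this
  refine ⟨_, Measure.addHaarScalarFactor_pos_of_isAddHaarMeasure
    (μH[((m + 1 : ℕ) : ℝ)] : Measure (EuclideanSpace ℝ (Fin (m + 1)))) volume, fun A => ?_⟩
  have hv : volume (WithLp.toLp 2 '' A : Set (EuclideanSpace ℝ (Fin (m + 1)))) = volume A := by
    have := (PiLp.volume_preserving_toLp (Fin (m + 1))).measure_preimage_emb
      (MeasurableEquiv.toLp 2 (Fin (m + 1) → ℝ)).measurableEmbedding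
      (WithLp.toLp 2 '' A)
    rw [← this, preimage_image_eq _ (WithLp.toLp_injective 2)]
  rw [← hv]
  exact congrArg (fun μ : Measure (EuclideanSpace ℝ (Fin (m + 1))) => μ (WithLp.toLp 2 '' A))
    (Measure.isAddLeftInvariant_eq_smul
      (μH[((m + 1 : ℕ) : ℝ)] : Measure (EuclideanSpace ℝ (Fin (m + 1)))) volume)

/-- Inserting a constant coordinate is an isometric embedding of Euclidean spaces. -/
lemma isometry_toLp_insertNth (m : ℕ) (i : Fin (m + 2)) (t : ℝ) :
    Isometry (fun w : EuclideanSpace ℝ (Fin (m + 1)) =>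
      (WithLp.toLp 2 (i.insertNth t w.ofLp : Fin (m + 2) → ℝ) :
        EuclideanSpace ℝ (Fin (m + 2)))) := by
  refine Isometry.of_dist_eq fun v w => ?_
  rw [EuclideanSpace.dist_eq, EuclideanSpace.dist_eq, Fin.sum_univ_succAbove _ i]
  simp

/-- The radial projection is Lipschitz where the norm is bounded above and the gauge below. -/
lemma lipschitzOnWith_inv_smul {E : Type*} [NormedAddCommGroup E] [NormedSpace ℝ E]
    {g : E → ℝ} {K : ℝ≥0} (hg : LipschitzWith K g) {δ r : ℝ≥0} (hδ : 0 < δ) {F : Set E}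
    (hF : ∀ x ∈ F, ‖x‖ ≤ r ∧ δ ≤ g x) :
    LipschitzOnWith (δ⁻¹ + r * K * δ⁻¹ * δ⁻¹) (fun x => (g x)⁻¹ • x) F := by
  refine LipschitzOnWith.of_dist_le_mul fun x hx y hy => ?_
  obtain ⟨-, hx2⟩ := hF x hx
  obtain ⟨hy1, hy2⟩ := hF y hy
  have hδ' : (0 : ℝ) < δ := hδ
  have hgx := hδ'.trans_le hx2
  have hgy := hδ'.trans_le hy2
  have key : (g x)⁻¹ • x - (g y)⁻¹ • y =
      (g x)⁻¹ • (x - y) + ((g y - g x) * (g x)⁻¹ * (g y)⁻¹) • y := by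
    have : (g y - g x) * (g x)⁻¹ * (g y)⁻¹ = (g x)⁻¹ - (g y)⁻¹ := by field_simp
    rw [this]
    module
  have hL : |g y - g x| ≤ K * ‖x - y‖ := by
    have := hg.dist_le_mul y x
    rwa [Real.dist_eq, dist_comm, dist_eq_norm] at this
  have hix : (g x)⁻¹ ≤ (δ : ℝ)⁻¹ := inv_anti₀ hδ' hx2
  have hiy : (g y)⁻¹ ≤ (δ : ℝ)⁻¹ := inv_anti₀ hδ' hy2
  have hix0 : 0 < (g x)⁻¹ := by positivity
  have hiy0 : 0 < (g y)⁻¹ := by positivity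
  rw [dist_eq_norm, dist_eq_norm, key]
  refine (norm_add_le _ _).trans ?_
  rw [norm_smul, norm_smul, norm_mul, norm_mul, Real.norm_of_nonneg hix0.le,
    Real.norm_of_nonneg hiy0.le, Real.norm_eq_abs]
  have h1 : (g x)⁻¹ * ‖x - y‖ ≤ (δ : ℝ)⁻¹ * ‖x - y‖ := by gcongr
  have h2 : |g y - g x| * (g x)⁻¹ * (g y)⁻¹ * ‖y‖ ≤
      (K * ‖x - y‖) * (δ : ℝ)⁻¹ * (δ : ℝ)⁻¹ * r := by gcongr
  push_cast
  nlinarith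

/-- The boundary of a bounded convex open set has finite surface area. -/
lemma hausdorffMeasure_frontier_lt_top (m : ℕ) {Ω : Set (EuclideanSpace ℝ (Fin (m + 2)))}
    (hbd : IsBounded Ω) (hop : IsOpen Ω) (hconv : Convex ℝ Ω) (h0 : 0 ∈ Ω) :
    μH[((m + 1 : ℕ) : ℝ)] (frontier Ω) < ∞ := by
  have hnhds : Ω ∈ nhds 0 := hop.mem_nhds h0
  obtain ⟨K, hK⟩ := hconv.lipschitz_gauge hnhds
  obtain ⟨r, hr0, hr⟩ := hbd.exists_pos_norm_le
  obtain ⟨κ, -, hκ⟩ := exists_hausdorffMeasure_toLp_image m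
  set face : Fin (m + 2) → ℝ → Set (EuclideanSpace ℝ (Fin (m + 2))) := fun i t =>
    (fun w : EuclideanSpace ℝ (Fin (m + 1)) =>
      (WithLp.toLp 2 (i.insertNth t w.ofLp : Fin (m + 2) → ℝ) :
        EuclideanSpace ℝ (Fin (m + 2)))) '' (WithLp.toLp 2 '' Icc (-1) 1) with hface
  have hfin : ∀ i t, μH[((m + 1 : ℕ) : ℝ)] (face i t) < ∞ := by
    intro i t
    rw [hface]
    dsimp only
    rw [(isometry_toLp_insertNth m i t).hausdorffMeasure_image (Or.inl (by positivity)), hκ]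
    exact ENNReal.mul_lt_top ENNReal.coe_lt_top isCompact_Icc.measure_lt_top
  set f : EuclideanSpace ℝ (Fin (m + 2)) → EuclideanSpace ℝ (Fin (m + 2)) :=
    fun x => (gauge Ω x)⁻¹ • x with hf
  have himg : ∀ i t, |t| = 1 → μH[((m + 1 : ℕ) : ℝ)] (f '' face i t) < ∞ := by
    intro i t ht
    have hcomp : IsBounded (face i t) :=
      ((isCompact_Icc.image (PiLp.continuous_toLp 2 _)).image
        (isometry_toLp_insertNth m i t).continuous).isBounded
    obtain ⟨s, hs0, hs⟩ := hcomp.exists_pos_norm_le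
    have hlip : LipschitzOnWith _ f (face i t) :=
      lipschitzOnWith_inv_smul hK (δ := (1 / r).toNNReal) (r := s.toNNReal)
        (Real.toNNReal_pos.2 (by positivity)) (by
          intro x hx
          rw [Real.coe_toNNReal _ hs0.le, Real.coe_toNNReal _ (by positivity)]
          refine ⟨hs x hx, ?_⟩
          have h1 : ‖x‖ / r ≤ gauge Ω x :=
            le_gauge_of_subset_closedBall (absorbent_nhds_zero hnhds) hr0.le
              (fun y hy => by simpa using hr y hy)
          refine le_trans ?_ h1
          gcongr
          obtain ⟨w, -, rfl⟩ := hx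
          have := PiLp.norm_apply_le (p := 2)
            (WithLp.toLp 2 (i.insertNth t w.ofLp : Fin (m + 2) → ℝ) :
              EuclideanSpace ℝ (Fin (m + 2))) i
          simpa [ht] using this)
    refine (hlip.hausdorffMeasure_image_le (by positivity)).trans_lt ?_
    exact ENNReal.mul_lt_top (ENNReal.rpow_lt_top_of_nonneg (by positivity) ENNReal.coe_ne_top)
      (hfin i t)
  have hcover : frontier Ω ⊆ ⋃ i : Fin (m + 2), (f '' face i 1 ∪ f '' face i (-1)) := by
    intro p hp
    have hg : gauge Ω p = 1 := (gauge_eq_one_iff_mem_frontier hconv hnhds).2 hp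
    obtain ⟨i, -, hi⟩ := Finset.exists_max_image (Finset.univ : Finset (Fin (m + 2)))
      (fun i => |p i|) ⟨0, Finset.mem_univ _⟩
    have hpi : 0 < |p i| := by
      by_contra! hcon
      have hp0 : p = 0 := by
        ext j
        have := (hi j (Finset.mem_univ _)).trans hcon
        simpa using this
      rw [hp0, gauge_zero] at hg
      norm_num at hg
    have hmem : |p i|⁻¹ • p ∈ face i (|p i|⁻¹ * p i) := by
      refine ⟨WithLp.toLp 2 (fun j => |p i|⁻¹ * p (i.succAbove j)), ⟨_, ?_, rfl⟩, ?_⟩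
      · have : ∀ j, |(|p i|⁻¹ * p (i.succAbove j))| ≤ 1 := by
          intro j
          rw [abs_mul, abs_inv, abs_abs, inv_mul_le_iff₀ hpi, mul_one]
          exact hi _ (Finset.mem_univ _)
        exact ⟨fun j => (abs_le.1 (this j)).1, fun j => (abs_le.1 (this j)).2⟩
      · ext j
        refine Fin.succAboveCases i ?_ (fun j => ?_) j <;> simp
    have hfp : f (|p i|⁻¹ • p) = p := by
      rw [hf]
      dsimp only
      rw [gauge_smul_of_nonneg (by positivity), hg, smul_eq_mul, mul_one, inv_inv, smul_smul,
        mul_inv_cancel₀ hpi.ne', one_smul]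
    refine mem_iUnion.2 ⟨i, ?_⟩
    rcases abs_cases (p i) with ⟨h1, -⟩ | ⟨h1, -⟩
    · left
      refine ⟨_, ?_, hfp⟩
      convert hmem using 2
      rw [h1] at hpi ⊢
      field_simp
    · right
      refine ⟨_, ?_, hfp⟩
      convert hmem using 2
      rw [h1] at hpi ⊢
      have : p i ≠ 0 := by intro h; simp [h] at hpi
      field_simp
  refine (measure_mono hcover).trans_lt ((measure_iUnion_le _).trans_lt ?_)
  rw [tsum_fintype]
  refine ENNReal.sum_lt_top.2 fun i _ => (measure_union_le _ _).trans_lt ?_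
  exact ENNReal.add_lt_top.2 ⟨himg i 1 (by simp), himg i (-1) (by simp)⟩

/-- The slice of a set by the hyperplane where the `i`-th coordinate equals `t`. -/
def coordSlice {m : ℕ} (A : Set (EuclideanSpace ℝ (Fin (m + 2)))) (i : Fin (m + 2)) (t : ℝ) :
    Set (Fin (m + 1) → ℝ) :=
  {w | WithLp.toLp 2 (i.insertNth t w : Fin (m + 2) → ℝ) ∈ A}

lemma isCompact_coordSlice {m : ℕ} {A : Set (EuclideanSpace ℝ (Fin (m + 2)))}
    (hA : IsCompact A) (i : Fin (m + 2)) (t : ℝ) : IsCompact (coordSlice A i t) := by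
  have h := ((isometry_toLp_insertNth m i t).isClosedEmbedding.isCompact_preimage hA).image
    (PiLp.continuous_ofLp 2 _)
  convert h using 1
  ext w
  constructor
  · intro hw
    exact ⟨WithLp.toLp 2 w, hw, rfl⟩
  · rintro ⟨v, hv, rfl⟩
    exact hv

/-- The projection along the direction `(c, σ, 0, …, 0)`. -/
def tiltProj (m : ℕ) (c σ : ℝ) (x : EuclideanSpace ℝ (Fin (m + 2))) :
    EuclideanSpace ℝ (Fin (m + 1)) :=
  WithLp.toLp 2 (Fin.cons (c * x 1 - σ * x 0) (fun i : Fin m => x i.succ.succ))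

lemma lipschitzWith_tiltProj (m : ℕ) {c σ : ℝ} (h : c ^ 2 + σ ^ 2 = 1) :
    LipschitzWith 1 (tiltProj m c σ) := by
  refine LipschitzWith.of_dist_le_mul fun x y => ?_
  rw [NNReal.coe_one, one_mul, EuclideanSpace.dist_eq, EuclideanSpace.dist_eq]
  refine Real.sqrt_le_sqrt ?_
  rw [Fin.sum_univ_succ, Fin.sum_univ_succ (n := m + 1), Fin.sum_univ_succ (n := m), ← add_assoc]
  simp only [tiltProj, Fin.cons_zero, Fin.cons_succ, Real.dist_eq, sq_abs]
  refine add_le_add ?_ le_rfl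
  have : (Fin.succ 0 : Fin (m + 2)) = 1 := rfl
  rw [this]
  nlinarith [sq_nonneg (c * (x 0 - y 0) + σ * (x 1 - y 1)),
    congrArg (· * ((x 0 - y 0) ^ 2 + (x 1 - y 1) ^ 2)) h]

/-- Points of the closure are shadows, along `(c, σ, 0, …, 0)`, of boundary points further along. -/
lemma exists_frontier_tiltProj_eq {m : ℕ} {Ω : Set (EuclideanSpace ℝ (Fin (m + 2)))}
    (hbd : IsBounded Ω) {c σ : ℝ} (h : c ^ 2 + σ ^ 2 = 1)
    {p : EuclideanSpace ℝ (Fin (m + 2))} (hp : p ∈ closure Ω) :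
    ∃ q ∈ frontier Ω, ∃ τ : ℝ, 0 ≤ τ ∧ q 0 = p 0 + τ * c ∧ q 1 = p 1 + τ * σ ∧
      tiltProj m c σ q = tiltProj m c σ p := by
  set e : EuclideanSpace ℝ (Fin (m + 2)) :=
    WithLp.toLp 2 (Fin.cons c (Fin.cons σ 0)) with he
  have he0 : e 0 = c := rfl
  have he1 : e 1 = σ := rfl
  have hne : e ≠ 0 := by
    intro h0
    rw [h0] at he0 he1
    simp only [PiLp.zero_apply] at he0 he1
    rw [← he0, ← he1] at h
    norm_num at h
  obtain ⟨τ, hτ, hq⟩ := exists_ray_mem_frontier hbd hp hne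
  refine ⟨_, hq, τ, hτ, by simp [he0], by simp [he1], ?_⟩
  ext i
  refine Fin.cases ?_ (fun j => ?_) i
  · simp only [tiltProj, Fin.cons_zero, PiLp.add_apply, PiLp.smul_apply, smul_eq_mul, he0, he1]
    ring
  · simp [tiltProj, he]

/-- Area bound for a tilted shadow of the part of the boundary above `x₀ = h` with `x₁ ≥ s`. -/
lemma tilted_shadow_le {m : ℕ} {Ω : Set (EuclideanSpace ℝ (Fin (m + 2)))}
    (hbd : IsBounded Ω) {κ : ℝ≥0}
    (hκ : ∀ A : Set (Fin (m + 1) → ℝ),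
      (μH[((m + 1 : ℕ) : ℝ)] : Measure (EuclideanSpace ℝ (Fin (m + 1))))
        (WithLp.toLp 2 '' A) = κ * volume A)
    {c σ : ℝ} (hc : 0 ≤ c) (hσ : 0 ≤ σ) (h1 : c ^ 2 + σ ^ 2 = 1) (h s : ℝ) :
    κ * (ENNReal.ofReal c * volume (coordSlice (closure Ω) 0 h ∩ {y | s ≤ y 0}) +
        ENNReal.ofReal σ * volume (coordSlice (closure Ω) 1 s ∩ {w | h ≤ w 0})) ≤
      μH[((m + 1 : ℕ) : ℝ)] (frontier Ω ∩ {x | h ≤ x 0 ∧ s ≤ x 1}) := by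
  have hK : IsCompact (closure Ω) := hbd.isCompact_closure
  set D := coordSlice (closure Ω) 0 h ∩ {y | s ≤ y 0} with hD
  set M := coordSlice (closure Ω) 1 s ∩ {w | h ≤ w 0} with hM
  have hMc : IsCompact M := (isCompact_coordSlice hK 1 s).inter_right
    (isClosed_le continuous_const (continuous_apply 0))
  set FD : (Fin (m + 1) → ℝ) → (Fin (m + 1) → ℝ) := fun y =>
    Fin.cons (c * y 0 + (-(σ * h))) (Fin.tail y) with hFD
  set FM : (Fin (m + 1) → ℝ) → (Fin (m + 1) → ℝ) := fun y =>
    Fin.cons (-σ * y 0 + c * s) (Fin.tail y) with hFM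
  have hvD : volume (FD '' D) = ENNReal.ofReal c * volume D := by
    rw [hFD, volume_image_cons_affine, abs_of_nonneg hc]
  have hvM : volume (FM '' M) = ENNReal.ofReal σ * volume M := by
    rw [hFM, volume_image_cons_affine, abs_neg, abs_of_nonneg hσ]
  have hdisj : AEDisjoint volume (FD '' D) (FM '' M) := by
    refine measure_mono_null (t := {f : Fin (m + 1) → ℝ | f 0 = c * s - σ * h}) ?_
      (Measure.pi_hyperplane _ 0 _)
    rintro _ ⟨⟨y, hy, rfl⟩, w, hw, hyw⟩
    have hy2 : s ≤ y 0 := hy.2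
    have hw2 : h ≤ w 0 := hw.2
    have h3 := congrFun hyw 0
    simp only [hFD, hFM, Fin.cons_zero] at h3
    simp only [hFD, mem_ofPred_eq, Fin.cons_zero]
    nlinarith
  have hmeas : NullMeasurableSet (FM '' M) volume := by
    refine (hMc.image ?_).measurableSet.nullMeasurableSet
    refine continuous_pi fun i => Fin.cases ?_ (fun j => ?_) i
    · simp only [hFM, Fin.cons_zero]; fun_prop
    · simp only [hFM, Fin.cons_succ, Fin.tail]; fun_prop
  rw [← hvD, ← hvM, ← measure_union₀ hmeas hdisj, ← hκ]
  have hsub : (WithLp.toLp 2 '' (FD '' D ∪ FM '' M) : Set (EuclideanSpace ℝ (Fin (m + 1)))) ⊆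
      tiltProj m c σ '' (frontier Ω ∩ {x | h ≤ x 0 ∧ s ≤ x 1}) := by
    rintro _ ⟨_, ⟨y, hy, rfl⟩ | ⟨w, hw, rfl⟩, rfl⟩
    · obtain ⟨q, hq, τ, hτ, hq0, hq1, hT⟩ := exists_frontier_tiltProj_eq hbd h1 hy.1
      have hy2 : s ≤ y 0 := hy.2
      have e0 : ((0 : Fin (m + 2)).insertNth h y : Fin (m + 2) → ℝ) 0 = h := by simp
      have e1 : ((0 : Fin (m + 2)).insertNth h y : Fin (m + 2) → ℝ) 1 = y 0 := by
        rw [Fin.insertNth_zero']; rfl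
      refine ⟨q, ⟨hq, ?_, ?_⟩, ?_⟩
      · simp only [hq0, e0]; nlinarith
      · simp only [hq1, e1]; nlinarith
      · rw [hT]
        simp only [tiltProj, hFD, e0, e1]
        congr 1
    · obtain ⟨q, hq, τ, hτ, hq0, hq1, hT⟩ := exists_frontier_tiltProj_eq hbd h1 hw.1
      have hw2 : h ≤ w 0 := hw.2
      have e0 : ((1 : Fin (m + 2)).insertNth s w : Fin (m + 2) → ℝ) 0 = w 0 := by
        have := Fin.insertNth_apply_succAbove (α := fun _ => ℝ) (1 : Fin (m + 2)) s w 0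
        simpa using this
      have e1 : ((1 : Fin (m + 2)).insertNth s w : Fin (m + 2) → ℝ) 1 = s := by simp
      have e2 : ∀ j : Fin m, ((1 : Fin (m + 2)).insertNth s w : Fin (m + 2) → ℝ) j.succ.succ =
          w j.succ := by
        intro j
        have := Fin.insertNth_apply_succAbove (α := fun _ => ℝ) (1 : Fin (m + 2)) s w j.succ
        rwa [Fin.succAbove_of_le_castSucc _ _ (by
          rw [Fin.le_def]; simp)] at this
      refine ⟨q, ⟨hq, ?_, ?_⟩, ?_⟩
      · simp only [hq0, e0]; nlinarith
      · simp only [hq1, e1]; nlinarith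
      · rw [hT]
        simp only [tiltProj, hFM, e0, e1, e2]
        congr 1
        ext i
        refine Fin.cases ?_ (fun j => ?_) i
        · simp; ring
        · simp [Fin.tail]
  refine (measure_mono hsub).trans ?_
  simpa using (lipschitzWith_tiltProj m h1).hausdorffMeasure_image_le
    (d := ((m + 1 : ℕ) : ℝ)) (by positivity) (frontier Ω ∩ {x | h ≤ x 0 ∧ s ≤ x 1})

/-- Area bound for the vertical shadow of the part of the boundary above `x₀ = h` with `x₁ < s`. -/
lemma vertical_shadow_le {m : ℕ} {Ω : Set (EuclideanSpace ℝ (Fin (m + 2)))}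
    (hbd : IsBounded Ω) {κ : ℝ≥0}
    (hκ : ∀ A : Set (Fin (m + 1) → ℝ),
      (μH[((m + 1 : ℕ) : ℝ)] : Measure (EuclideanSpace ℝ (Fin (m + 1))))
        (WithLp.toLp 2 '' A) = κ * volume A) (h s : ℝ) :
    κ * volume (coordSlice (closure Ω) 0 h ∩ {y | y 0 < s}) ≤
      μH[((m + 1 : ℕ) : ℝ)] (frontier Ω ∩ {x | h ≤ x 0 ∧ x 1 < s}) := by
  have h1 : (1 : ℝ) ^ 2 + 0 ^ 2 = 1 := by norm_num
  rw [← hκ]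
  have hsub : (WithLp.toLp 2 '' (coordSlice (closure Ω) 0 h ∩ {y | y 0 < s}) :
      Set (EuclideanSpace ℝ (Fin (m + 1)))) ⊆
      tiltProj m 1 0 '' (frontier Ω ∩ {x | h ≤ x 0 ∧ x 1 < s}) := by
    rintro _ ⟨y, hy, rfl⟩
    obtain ⟨q, hq, τ, hτ, hq0, hq1, hT⟩ :=
      exists_frontier_tiltProj_eq hbd h1 hy.1
    have hy2 : y 0 < s := hy.2
    have e0 : ((0 : Fin (m + 2)).insertNth h y : Fin (m + 2) → ℝ) 0 = h := by simp
    have e1 : ((0 : Fin (m + 2)).insertNth h y : Fin (m + 2) → ℝ) 1 = y 0 := by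
      rw [Fin.insertNth_zero']; rfl
    refine ⟨q, ⟨hq, ?_, ?_⟩, ?_⟩
    · simp only [hq0, e0]; linarith
    · simp only [hq1, e1]; linarith
    · rw [hT]
      simp only [tiltProj, e0, e1]
      congr 1
      ext i
      refine Fin.cases ?_ (fun j => ?_) i <;> simp
  refine (measure_mono hsub).trans ?_
  simpa using (lipschitzWith_tiltProj m h1).hausdorffMeasure_image_le
    (d := ((m + 1 : ℕ) : ℝ)) (by positivity) (frontier Ω ∩ {x | h ≤ x 0 ∧ x 1 < s})

/-- Cavalieri's principle along the `i`-th coordinate. -/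
lemma volume_eq_lintegral_coordSlice {m : ℕ} {A : Set (EuclideanSpace ℝ (Fin (m + 2)))}
    (hA : MeasurableSet A) (i : Fin (m + 2)) :
    volume A = ∫⁻ t, volume (coordSlice A i t) := by
  have h1 := (PiLp.volume_preserving_toLp (Fin (m + 2))).comp
    ((volume_preserving_piFinSuccAbove (fun _ : Fin (m + 2) => ℝ) i).symm)
  rw [← h1.measure_preimage hA.nullMeasurableSet, Measure.volume_eq_prod,
    Measure.prod_apply (h1.measurable hA)]
  rfl

/-- A convex body with an apex at height `h + ε` above its section contains a prism. -/
lemma volume_cap_ge {m : ℕ} {K : Set (EuclideanSpace ℝ (Fin (m + 2)))}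
    (hK : IsCompact K) (hconv : Convex ℝ K) (h0 : 0 ∈ K) {R ε : ℝ} (hε : 0 < ε) (hεR : ε < R)
    (hapex : WithLp.toLp 2 (Fin.cons R 0 : Fin (m + 2) → ℝ) ∈ K) :
    ENNReal.ofReal (ε / 2 * (1 / 2) ^ (m + 1)) * volume (coordSlice K 0 (R - ε)) ≤
      volume (K ∩ {x | R - ε ≤ x 0}) := by
  have hmeas : MeasurableSet (K ∩ {x : EuclideanSpace ℝ (Fin (m + 2)) | R - ε ≤ x 0}) :=
    (hK.inter_right (isClosed_le continuous_const (by fun_prop))).measurableSet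
  rw [volume_eq_lintegral_coordSlice hmeas 0]
  have hsub : ∀ t ∈ Icc (R - ε) (R - ε + ε / 2),
      ENNReal.ofReal ((1 / 2) ^ (m + 1)) * volume (coordSlice K 0 (R - ε)) ≤
        volume (coordSlice (K ∩ {x | R - ε ≤ x 0}) 0 t) := by
    rintro t ⟨ht1, ht2⟩
    have := Measure.addHaar_smul (volume : Measure (Fin (m + 1) → ℝ)) (1 / 2)
      (coordSlice K 0 (R - ε))
    rw [Module.finrank_fin_fun, abs_of_nonneg (by positivity)] at this
    rw [← this]
    refine measure_mono ?_
    rintro _ ⟨y, hy, rfl⟩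
    have hR : 0 < R := hε.trans hεR
    set α := (t - (R - ε) / 2) / R with hα
    have hαR : α * R = t - (R - ε) / 2 := by rw [hα]; field_simp
    have hα0 : 0 ≤ α := div_nonneg (by linarith) hR.le
    have hα1 : α ≤ 1 / 2 := by rw [hα, div_le_iff₀ hR]; linarith
    refine ⟨?_, by simpa using ht1⟩
    have hz : α • WithLp.toLp 2 (Fin.cons R 0 : Fin (m + 2) → ℝ) =
        (1 / 2 : ℝ) • ((2 * α) • WithLp.toLp 2 (Fin.cons R 0 : Fin (m + 2) → ℝ)) := by
      rw [smul_smul]; congr 1; ring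
    have hq : (2 * α) • WithLp.toLp 2 (Fin.cons R 0 : Fin (m + 2) → ℝ) ∈ K :=
      hconv.smul_mem_of_zero_mem h0 hapex ⟨by linarith, by linarith⟩
    have hmem := hconv hy hq (a := 1 / 2) (b := 1 / 2) (by norm_num) (by norm_num) (by norm_num)
    rw [← hz] at hmem
    convert hmem using 1
    ext i
    refine Fin.cases ?_ (fun j => ?_) i
    · simp [hαR]
      ring
    · simp
  calc ENNReal.ofReal (ε / 2 * (1 / 2) ^ (m + 1)) * volume (coordSlice K 0 (R - ε))
      = ∫⁻ _ in Icc (R - ε) (R - ε + ε / 2),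
          ENNReal.ofReal ((1 / 2) ^ (m + 1)) * volume (coordSlice K 0 (R - ε)) := by
        rw [setLIntegral_const, Real.volume_Icc, add_sub_cancel_left,
          ENNReal.ofReal_mul (by positivity)]
        ring
    _ ≤ ∫⁻ t in Icc (R - ε) (R - ε + ε / 2),
          volume (coordSlice (K ∩ {x | R - ε ≤ x 0}) 0 t) :=
        setLIntegral_mono' measurableSet_Icc hsub
    _ ≤ _ := setLIntegral_le_lintegral _ _

/-- Some slice of a body of bounded width is at least as large as half the average slice. -/
lemma exists_large_coordSlice {m : ℕ} {K : Set (EuclideanSpace ℝ (Fin (m + 2)))}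
    (hK : IsCompact K) (i : Fin (m + 2)) {ρ : ℝ} (hρ : 0 < ρ) (hw : ∀ x ∈ K, |x i| ≤ ρ) :
    ∃ s, volume K ≤ ENNReal.ofReal (4 * ρ) * volume (coordSlice K i s) := by
  by_contra! hcon
  have hpos : volume K ≠ 0 := (zero_le.trans_lt (hcon 0)).ne'
  have hfin : volume K ≠ ∞ := hK.measure_lt_top.ne
  have hle : ENNReal.ofReal (4 * ρ) * volume K ≤ volume K * ENNReal.ofReal (2 * ρ) :=
    calc ENNReal.ofReal (4 * ρ) * volume K
        = ∫⁻ s, ENNReal.ofReal (4 * ρ) * volume (coordSlice K i s) := by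
          rw [lintegral_const_mul' _ _ ENNReal.ofReal_ne_top,
            ← volume_eq_lintegral_coordSlice hK.measurableSet]
      _ ≤ ∫⁻ s, (Icc (-ρ) ρ).indicator (fun _ => volume K) s := by
          refine lintegral_mono fun s => ?_
          by_cases hs : s ∈ Icc (-ρ) ρ
          · rw [indicator_of_mem hs]
            exact (hcon s).le
          · have : coordSlice K i s = ∅ := by
              refine eq_empty_of_forall_notMem fun w hws => hs ?_
              have := hw _ hws
              simp only [Fin.insertNth_apply_same] at this
              exact abs_le.1 this
            simp [this]
      _ = volume K * ENNReal.ofReal (2 * ρ) := by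
          rw [lintegral_indicator_const measurableSet_Icc, Real.volume_Icc]
          congr 2
          ring
  rw [mul_comm, ENNReal.mul_le_mul_iff_right hpos hfin,
    ENNReal.ofReal_le_ofReal_iff (by positivity)] at hle
  linarith

lemma hausdorffMeasure_sub_one_eq (m : ℕ) (A : Set (EuclideanSpace ℝ (Fin (m + 2)))) :
    μH[((m + 2 : ℕ) : ℝ) - 1] A = μH[((m + 1 : ℕ) : ℝ)] A := by
  congr 2
  push_cast
  ring

/-- Cropping loses the boundary above the cut and gains at most the section of the closure. -/
lemma perim_sub_perim_crop_ge {m : ℕ} {Ω : Set (EuclideanSpace ℝ (Fin (m + 2)))}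
    (hbd : IsBounded Ω) (hfin : μH[((m + 1 : ℕ) : ℝ)] (frontier Ω) < ∞) {κ : ℝ≥0}
    (hκ : ∀ A : Set (Fin (m + 1) → ℝ),
      (μH[((m + 1 : ℕ) : ℝ)] : Measure (EuclideanSpace ℝ (Fin (m + 1))))
        (WithLp.toLp 2 '' A) = κ * volume A) (h : ℝ) :
    (μH[((m + 1 : ℕ) : ℝ)] (frontier Ω ∩ {x | h ≤ x 0})).toReal -
        κ * (volume (coordSlice (closure Ω) 0 h)).toReal ≤
      perim (m + 2) Ω - perim (m + 2) (Ω ∩ {x | x 0 < h}) := by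
  have hDfin : volume (coordSlice (closure Ω) 0 h) ≠ ∞ :=
    (isCompact_coordSlice hbd.isCompact_closure 0 h).measure_lt_top.ne
  have hc0 : Continuous fun x : EuclideanSpace ℝ (Fin (m + 2)) => x 0 := by fun_prop
  have hsec : μH[((m + 1 : ℕ) : ℝ)] (closure Ω ∩ {x | x 0 = h}) =
      κ * volume (coordSlice (closure Ω) 0 h) := by
    rw [← hκ, ← (isometry_toLp_insertNth m 0 h).hausdorffMeasure_image (Or.inl (by positivity))]
    congr 1
    ext x
    constructor
    · rintro ⟨hx, hx0⟩
      have hx0 : x 0 = h := hx0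
      have hxe : WithLp.toLp 2 ((0 : Fin (m + 2)).insertNth h (fun j => x j.succ) :
          Fin (m + 2) → ℝ) = x := by
        ext i
        refine Fin.cases ?_ (fun j => ?_) i
        · simp [hx0]
        · simp
      refine ⟨WithLp.toLp 2 (fun j => x j.succ), ⟨_, ?_, rfl⟩, hxe⟩
      change WithLp.toLp 2 ((0 : Fin (m + 2)).insertNth h (fun j => x j.succ) :
          Fin (m + 2) → ℝ) ∈ closure Ω
      rwa [hxe]
    · rintro ⟨_, ⟨y, hy, rfl⟩, rfl⟩
      exact ⟨hy, by simp⟩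
  have hsub : frontier (Ω ∩ {x | x 0 < h}) ⊆
      (frontier Ω ∩ {x | x 0 < h}) ∪ (closure Ω ∩ {x | x 0 = h}) := by
    intro x hx
    rcases frontier_inter_subset _ _ hx with ⟨h1, h2⟩ | ⟨h1, h2⟩
    · have h3 : x 0 ≤ h := closure_lt_subset_le hc0 continuous_const h2
      rcases h3.lt_or_eq with h4 | h4
      · exact Or.inl ⟨h1, h4⟩
      · exact Or.inr ⟨frontier_subset_closure h1, h4⟩
    · exact Or.inr ⟨h1, frontier_lt_subset_eq hc0 continuous_const h2⟩
  have hsplit : μH[((m + 1 : ℕ) : ℝ)] (frontier Ω) =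
      μH[((m + 1 : ℕ) : ℝ)] (frontier Ω ∩ {x | x 0 < h}) +
        μH[((m + 1 : ℕ) : ℝ)] (frontier Ω ∩ {x | h ≤ x 0}) := by
    rw [← measure_inter_add_sdiff (frontier Ω)
      (isOpen_lt hc0 continuous_const).measurableSet]
    congr 2
    ext x
    simp
  have hlow : μH[((m + 1 : ℕ) : ℝ)] (frontier Ω ∩ {x | x 0 < h}) ≠ ∞ :=
    ((measure_mono inter_subset_left).trans_lt hfin).ne
  have hup : μH[((m + 1 : ℕ) : ℝ)] (frontier Ω ∩ {x | h ≤ x 0}) ≠ ∞ :=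
    ((measure_mono inter_subset_left).trans_lt hfin).ne
  have hle := (measure_mono hsub).trans (measure_union_le (μ := μH[((m + 1 : ℕ) : ℝ)]) _ _)
  rw [hsec] at hle
  have hle' := ENNReal.toReal_mono
    (ENNReal.add_ne_top.2 ⟨hlow, ENNReal.mul_ne_top ENNReal.coe_ne_top hDfin⟩) hle
  rw [ENNReal.toReal_add hlow (ENNReal.mul_ne_top ENNReal.coe_ne_top hDfin),
    ENNReal.toReal_mul, ENNReal.coe_toReal] at hle'
  unfold perim
  rw [hausdorffMeasure_sub_one_eq, hausdorffMeasure_sub_one_eq, hsplit,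
    ENNReal.toReal_add hlow hup]
  linarith

/-- The lateral boundary of a cap exceeds its base by the tilted shadow of a vertical slice. -/
lemma lateral_area_ge {m : ℕ} {Ω : Set (EuclideanSpace ℝ (Fin (m + 2)))}
    (hbd : IsBounded Ω) (hfin : μH[((m + 1 : ℕ) : ℝ)] (frontier Ω) < ∞) {κ : ℝ≥0}
    (hκ : ∀ A : Set (Fin (m + 1) → ℝ),
      (μH[((m + 1 : ℕ) : ℝ)] : Measure (EuclideanSpace ℝ (Fin (m + 1))))
        (WithLp.toLp 2 '' A) = κ * volume A)
    {c σ : ℝ} (hc : 0 ≤ c) (hσ : 0 ≤ σ) (h1 : c ^ 2 + σ ^ 2 = 1) (h s : ℝ) :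
    κ * (c * (volume (coordSlice (closure Ω) 0 h)).toReal +
        σ * (volume (coordSlice (closure Ω) 1 s ∩ {w | h ≤ w 0})).toReal) ≤
      (μH[((m + 1 : ℕ) : ℝ)] (frontier Ω ∩ {x | h ≤ x 0})).toReal := by
  have hK : IsCompact (closure Ω) := hbd.isCompact_closure
  have hDfin : volume (coordSlice (closure Ω) 0 h) < ∞ :=
    (isCompact_coordSlice hK 0 h).measure_lt_top
  have hMfin : volume (coordSlice (closure Ω) 1 s ∩ {w | h ≤ w 0}) ≠ ∞ :=
    ((measure_mono inter_subset_left).trans_lt (isCompact_coordSlice hK 1 s).measure_lt_top).ne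
  have hDR : volume (coordSlice (closure Ω) 0 h ∩ {y | s ≤ y 0}) ≠ ∞ :=
    ((measure_mono inter_subset_left).trans_lt hDfin).ne
  have hDL : volume (coordSlice (closure Ω) 0 h ∩ {y | y 0 < s}) ≠ ∞ :=
    ((measure_mono inter_subset_left).trans_lt hDfin).ne
  have hDsplit : volume (coordSlice (closure Ω) 0 h) =
      volume (coordSlice (closure Ω) 0 h ∩ {y | y 0 < s}) +
        volume (coordSlice (closure Ω) 0 h ∩ {y | s ≤ y 0}) := by
    rw [← measure_inter_add_sdiff (coordSlice (closure Ω) 0 h)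
      (isOpen_lt (continuous_apply (0 : Fin (m + 1))) continuous_const).measurableSet]
    congr 2
    ext x
    simp
  have hSsplit : μH[((m + 1 : ℕ) : ℝ)] (frontier Ω ∩ {x | h ≤ x 0}) =
      μH[((m + 1 : ℕ) : ℝ)] (frontier Ω ∩ {x | h ≤ x 0 ∧ x 1 < s}) +
        μH[((m + 1 : ℕ) : ℝ)] (frontier Ω ∩ {x | h ≤ x 0 ∧ s ≤ x 1}) := by
    have hm : MeasurableSet {x : EuclideanSpace ℝ (Fin (m + 2)) | x 1 < s} :=
      (isOpen_lt (by fun_prop) continuous_const).measurableSet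
    rw [← measure_inter_add_sdiff (frontier Ω ∩ {x | h ≤ x 0}) hm]
    congr 2
    · ext x
      simp [and_assoc]
    · ext x
      simp [and_assoc]
  have hSL : μH[((m + 1 : ℕ) : ℝ)] (frontier Ω ∩ {x | h ≤ x 0 ∧ x 1 < s}) ≠ ∞ :=
    ((measure_mono inter_subset_left).trans_lt hfin).ne
  have hSR : μH[((m + 1 : ℕ) : ℝ)] (frontier Ω ∩ {x | h ≤ x 0 ∧ s ≤ x 1}) ≠ ∞ :=
    ((measure_mono inter_subset_left).trans_lt hfin).ne
  have hR := ENNReal.toReal_mono hSR (tilted_shadow_le hbd hκ hc hσ h1 h s)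
  have hL := ENNReal.toReal_mono hSL (vertical_shadow_le hbd hκ h s)
  rw [ENNReal.toReal_mul, ENNReal.toReal_add (ENNReal.mul_ne_top ENNReal.ofReal_ne_top hDR)
    (ENNReal.mul_ne_top ENNReal.ofReal_ne_top hMfin), ENNReal.toReal_mul, ENNReal.toReal_mul,
    ENNReal.toReal_ofReal hc, ENNReal.toReal_ofReal hσ, ENNReal.coe_toReal] at hR
  rw [ENNReal.toReal_mul, ENNReal.coe_toReal] at hL
  rw [hSsplit, hDsplit, ENNReal.toReal_add hSL hSR, ENNReal.toReal_add hDL hDR]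
  have hc1 : c ≤ 1 := by nlinarith
  have hcL : κ * (c * (volume (coordSlice (closure Ω) 0 h ∩ {y | y 0 < s})).toReal) ≤
      κ * (volume (coordSlice (closure Ω) 0 h ∩ {y | y 0 < s})).toReal :=
    mul_le_mul_of_nonneg_left (mul_le_of_le_one_left ENNReal.toReal_nonneg hc1) κ.2
  linarith

/-- The comparison of volume and perimeter losses when the farthest point is on the first axis. -/
lemma vol_change_le_perim_change_axis {m : ℕ} {Ω : Set (EuclideanSpace ℝ (Fin (m + 2)))}
    (hbd : IsBounded Ω) (hop : IsOpen Ω) (hconv : Convex ℝ Ω) (h0 : 0 ∈ Ω) {R : ℝ} (hR : 0 < R)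
    (hball : ∀ x ∈ closure Ω, ‖x‖ ≤ R)
    (hapex : WithLp.toLp 2 (Fin.cons R 0 : Fin (m + 2) → ℝ) ∈ closure Ω) :
    ∃ C : ℝ, 0 < C ∧ ∃ ε₀ : ℝ, 0 < ε₀ ∧ ∀ ε : ℝ, 0 < ε → ε < ε₀ →
      0 ≤ vol (m + 2) Ω - vol (m + 2) (Ω ∩ {x | x 0 < R - ε}) ∧
      vol (m + 2) Ω - vol (m + 2) (Ω ∩ {x | x 0 < R - ε}) ≤
        C * (perim (m + 2) Ω - perim (m + 2) (Ω ∩ {x | x 0 < R - ε})) := by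
  obtain ⟨κ, hκ0, hκ⟩ := exists_hausdorffMeasure_toLp_image m
  have hκ0' : (0 : ℝ) < κ := hκ0
  have hfin := hausdorffMeasure_frontier_lt_top m hbd hop hconv h0
  have hK : IsCompact (closure Ω) := hbd.isCompact_closure
  have hΩfin : volume Ω ≠ ∞ := hbd.measure_lt_top.ne
  set q := √(2 * R) with hq
  have hq0 : 0 < q := Real.sqrt_pos.2 (by positivity)
  set N : ℝ := 2 ^ (m + 2) with hN
  have hN0 : 0 < N := by positivity
  set a := 1 / (8 * q * N) with ha
  have ha0 : 0 < a := by positivity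
  have haN : a * N = 1 / (8 * q) := by rw [ha]; field_simp
  refine ⟨8 * q / (κ * a), by positivity, min R (1 / a ^ 2), by positivity, fun ε hε hε' => ?_⟩
  have hεR : ε < R := hε'.trans_le (min_le_left _ _)
  have hεa : a ^ 2 * ε ≤ 1 := by
    have := (hε'.trans_le (min_le_right _ _)).le
    rwa [le_div_iff₀ (by positivity), mul_comm] at this
  have hc0 : Continuous fun x : EuclideanSpace ℝ (Fin (m + 2)) => x 0 := by fun_prop
  have hvsplit : vol (m + 2) Ω = vol (m + 2) (Ω ∩ {x | x 0 < R - ε}) +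
      (volume (Ω \ {x | x 0 < R - ε})).toReal := by
    unfold vol
    rw [← ENNReal.toReal_add (measure_ne_top_of_subset inter_subset_left hΩfin)
      (measure_ne_top_of_subset sdiff_subset hΩfin),
      measure_inter_add_sdiff Ω (isOpen_lt hc0 continuous_const).measurableSet]
  set V := (volume (closure Ω ∩ {x | R - ε ≤ x 0})).toReal with hV
  have hcap : IsCompact (closure Ω ∩ {x | R - ε ≤ x 0}) :=
    hK.inter_right (isClosed_le continuous_const hc0)
  have hvV : (volume (Ω \ {x | x 0 < R - ε})).toReal ≤ V := by
    refine ENNReal.toReal_mono hcap.measure_lt_top.ne (measure_mono fun x hx => ?_)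
    exact ⟨subset_closure hx.1, by simpa using hx.2⟩
  rw [hvsplit, add_sub_cancel_left]
  refine ⟨ENNReal.toReal_nonneg, hvV.trans ?_⟩
  set D := (volume (coordSlice (closure Ω) 0 (R - ε))).toReal with hD
  have hDV : ε * D ≤ N * V := by
    have h1 := ENNReal.toReal_mono hcap.measure_lt_top.ne
      (volume_cap_ge hK hconv.closure (subset_closure h0) hε hεR hapex)
    rw [ENNReal.toReal_mul, ENNReal.toReal_ofReal (by positivity)] at h1
    have h2 : N * (ε / 2 * (1 / 2) ^ (m + 1)) = ε := by
      rw [hN, pow_succ 2 (m + 1), one_div, inv_pow]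
      field_simp
    calc ε * D = N * (ε / 2 * (1 / 2) ^ (m + 1) * D) := by rw [← mul_assoc, h2]
      _ ≤ N * V := by gcongr
  have hwidth : ∀ x ∈ closure Ω ∩ {x | R - ε ≤ x 0}, |x 1| ≤ q * √ε := by
    rintro x ⟨hx, hx0⟩
    have hx0 : R - ε ≤ x 0 := hx0
    have hnorm := hball x hx
    have hsq : x 0 ^ 2 + x 1 ^ 2 ≤ R ^ 2 := by
      have h1 : ‖x‖ ^ 2 ≤ R ^ 2 := by gcongr
      rw [EuclideanSpace.norm_sq_eq, Fin.sum_univ_succ, Fin.sum_univ_succ] at h1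
      simp only [Real.norm_eq_abs, sq_abs] at h1
      have h2 : 0 ≤ ∑ i : Fin m, x i.succ.succ ^ 2 := Finset.sum_nonneg fun i _ => sq_nonneg _
      have h3 : (Fin.succ 0 : Fin (m + 2)) = 1 := rfl
      rw [h3] at h1
      linarith
    rw [hq, ← Real.sqrt_mul (by positivity)]
    refine Real.abs_le_sqrt ?_
    nlinarith
  have hsε : 0 < √ε := Real.sqrt_pos.2 hε
  obtain ⟨s, hs⟩ := exists_large_coordSlice hcap 1 (by positivity : 0 < q * √ε) hwidth
  have hslice : coordSlice (closure Ω ∩ {x | R - ε ≤ x 0}) 1 s =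
      coordSlice (closure Ω) 1 s ∩ {w | R - ε ≤ w 0} := by
    ext w
    have := Fin.insertNth_apply_succAbove (α := fun _ => ℝ) (1 : Fin (m + 2)) s w 0
    have e0 : ((1 : Fin (m + 2)).insertNth s w : Fin (m + 2) → ℝ) 0 = w 0 := by simpa using this
    simp [coordSlice, e0]
  rw [hslice] at hs
  set M := (volume (coordSlice (closure Ω) 1 s ∩ {w | R - ε ≤ w 0})).toReal with hM
  have hMfin : volume (coordSlice (closure Ω) 1 s ∩ {w | R - ε ≤ w 0}) ≠ ∞ :=
    measure_ne_top_of_subset inter_subset_left (isCompact_coordSlice hK 1 s).measure_lt_top.ne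
  have hMV : V ≤ 4 * (q * √ε) * M := by
    have := ENNReal.toReal_mono (ENNReal.mul_ne_top ENNReal.ofReal_ne_top hMfin) hs
    rwa [ENNReal.toReal_mul, ENNReal.toReal_ofReal (by positivity)] at this
  have hσ2 : (a * √ε) ^ 2 = a ^ 2 * ε := by rw [mul_pow, Real.sq_sqrt hε.le]
  set c := √(1 - a ^ 2 * ε) with hc
  have hc2 : c ^ 2 = 1 - a ^ 2 * ε := Real.sq_sqrt (by linarith)
  have hcnn : 0 ≤ c := Real.sqrt_nonneg _
  have hc1 : 1 - c ≤ a ^ 2 * ε := by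
    have : c ≤ 1 := by nlinarith [mul_pos (pow_pos ha0 2) hε]
    nlinarith
  have hS := lateral_area_ge hbd hfin hκ hcnn (by positivity : 0 ≤ a * √ε)
    (by rw [hc2, hσ2]; ring) (R - ε) s
  have hP := perim_sub_perim_crop_ge hbd hfin hκ (R - ε)
  have hD0 : 0 ≤ D := ENNReal.toReal_nonneg
  have hgain : a * V ≤ 4 * q * (a * √ε * M) := by
    have := mul_le_mul_of_nonneg_left hMV ha0.le
    linarith
  have hloss : 8 * q * ((1 - c) * D) ≤ a * V := by
    calc 8 * q * ((1 - c) * D) ≤ 8 * q * (a ^ 2 * ε * D) := by gcongr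
      _ = 8 * q * a ^ 2 * (ε * D) := by ring
      _ ≤ 8 * q * a ^ 2 * (N * V) := by gcongr
      _ = 8 * q * a * (a * N) * V := by ring
      _ = a * V := by rw [haN]; field_simp
  have hfinal : κ * (a * V) ≤ 8 * q * (κ * (c * D + a * √ε * M) - κ * D) := by
    calc (κ : ℝ) * (a * V) ≤ κ * (8 * q * (a * √ε * M) - 8 * q * ((1 - c) * D)) := by
          refine mul_le_mul_of_nonneg_left ?_ hκ0'.le
          linarith
      _ = _ := by ring
  rw [div_mul_eq_mul_div, le_div_iff₀ (by positivity)]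
  calc V * (κ * a) = κ * (a * V) := by ring
    _ ≤ _ := hfinal
    _ ≤ _ := by
      refine mul_le_mul_of_nonneg_left ?_ (by positivity)
      linarith

lemma vol_image_linearIsometryEquiv {n : ℕ}
    (Φ : EuclideanSpace ℝ (Fin n) ≃ₗᵢ[ℝ] EuclideanSpace ℝ (Fin n))
    (A : Set (EuclideanSpace ℝ (Fin n))) : vol n (Φ '' A) = vol n A := by
  unfold vol
  rw [← Φ.measurePreserving.measure_preimage_emb
    Φ.toHomeomorph.measurableEmbedding, preimage_image_eq _ Φ.injective]

lemma perim_image_linearIsometryEquiv {n : ℕ}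
    (Φ : EuclideanSpace ℝ (Fin n) ≃ₗᵢ[ℝ] EuclideanSpace ℝ (Fin n))
    (A : Set (EuclideanSpace ℝ (Fin n))) : perim n (Φ '' A) = perim n A := by
  unfold perim
  have h1 : frontier (Φ '' A) = Φ '' frontier A := (Φ.toHomeomorph.image_frontier A).symm
  rw [h1, Φ.isometry.hausdorffMeasure_image (Or.inr Φ.surjective)]

open RealInnerProductSpace in
/-- cutting a bounded open convex set `Ω ∋ 0` by a halfspace at distance `ε`
from a farthest boundary point decreases the volume by at most a constant times the decrease
of the perimeter, for all small `ε`. -/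
theorem vol_change_le_perim_change (n : ℕ) (hn : 2 ≤ n)
    (Ω : Set (EuclideanSpace ℝ (Fin n)))
    (hbd : IsBounded Ω) (hop : IsOpen Ω) (hconv : Convex ℝ Ω)
    (h0 : (0 : EuclideanSpace ℝ (Fin n)) ∈ Ω)
    (xm : EuclideanSpace ℝ (Fin n)) (hxm : xm ∈ frontier Ω) (hxmax : ‖xm‖ = rmax n Ω) :
    ∃ C : ℝ, 0 < C ∧ ∃ ε₀ : ℝ, 0 < ε₀ ∧ ∀ ε : ℝ, 0 < ε → ε < ε₀ →
      0 ≤ vol n Ω - vol n (Ω ∩ {x | ⟪x, ‖xm‖⁻¹ • xm⟫ < rmax n Ω - ε}) ∧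
      vol n Ω - vol n (Ω ∩ {x | ⟪x, ‖xm‖⁻¹ • xm⟫ < rmax n Ω - ε}) ≤
        C * (perim n Ω - perim n (Ω ∩ {x | ⟪x, ‖xm‖⁻¹ • xm⟫ < rmax n Ω - ε})) := by
  obtain ⟨m, rfl⟩ : ∃ m, n = m + 2 := ⟨n - 2, by omega⟩
  have hxm0 : xm ≠ 0 := by
    rintro rfl
    rw [hop.frontier_eq] at hxm
    exact hxm.2 h0
  have hR : 0 < ‖xm‖ := norm_pos_iff.2 hxm0
  have hball : ∀ x ∈ closure Ω, ‖x‖ ≤ ‖xm‖ := by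
    intro x hx
    rw [hxmax]
    obtain ⟨r, hr⟩ := hbd.closure.exists_norm_le
    exact le_csSup ⟨r, by rintro _ ⟨y, hy, rfl⟩; exact hr y hy⟩ ⟨x, hx, rfl⟩
  set u := ‖xm‖⁻¹ • xm with hu
  have hu1 : ‖u‖ = 1 := by
    rw [hu, norm_smul, norm_inv, norm_norm, inv_mul_cancel₀ hR.ne']
  have horth : Orthonormal ℝ
      (({0} : Set (Fin (m + 2))).domRestrict fun _ : Fin (m + 2) => u) :=
    ⟨fun _ => hu1, fun i j hij => (hij (Subsingleton.elim i j)).elim⟩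
  obtain ⟨b, hb⟩ := horth.exists_orthonormalBasis_extension_of_card_eq (by simp)
  have hb0 : b 0 = u := hb 0 rfl
  set Φ := b.repr with hΦ
  have hΦ0 : ∀ x, Φ x 0 = ⟪x, u⟫ := by
    intro x
    rw [hΦ, b.repr_apply_apply, hb0, real_inner_comm]
  have hcl : closure (Φ '' Ω) = Φ '' closure Ω := (Φ.toHomeomorph.image_closure Ω).symm
  have hapex : WithLp.toLp 2 (Fin.cons ‖xm‖ 0 : Fin (m + 2) → ℝ) ∈ closure (Φ '' Ω) := by
    rw [hcl]
    refine ⟨xm, frontier_subset_closure hxm, ?_⟩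
    have hxu : xm = ‖xm‖ • b 0 := by
      rw [hb0, hu, smul_smul, mul_inv_cancel₀ hR.ne', one_smul]
    have hΦx : Φ xm = ‖xm‖ • EuclideanSpace.single 0 1 := by
      conv_lhs => rw [hxu]
      rw [map_smul, hΦ, b.repr_self]
    rw [hΦx]
    ext i
    refine Fin.cases ?_ (fun j => ?_) i <;> simp
  obtain ⟨C, hC, ε₀, hε₀, H⟩ := vol_change_le_perim_change_axis (Ω := Φ '' Ω)
    (Φ.lipschitz.isBounded_image hbd) (Φ.toHomeomorph.isOpenMap Ω hop)
    (hconv.linear_image Φ.toLinearEquiv.toLinearMap) ⟨0, h0, map_zero _⟩ hR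
    (by
      rw [hcl]
      rintro _ ⟨x, hx, rfl⟩
      rw [Φ.norm_map]
      exact hball x hx) hapex
  refine ⟨C, hC, ε₀, hε₀, fun ε h1 h2 => ?_⟩
  have hcrop : Φ '' Ω ∩ {x | x 0 < ‖xm‖ - ε} =
      Φ '' (Ω ∩ {x | ⟪x, u⟫ < rmax (m + 2) Ω - ε}) := by
    rw [← hxmax]
    ext x
    constructor
    · rintro ⟨⟨y, hy, rfl⟩, hy0⟩
      refine ⟨y, ⟨hy, ?_⟩, rfl⟩
      change ⟪y, u⟫ < _
      rw [← hΦ0]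
      exact hy0
    · rintro ⟨y, ⟨hy, hy0⟩, rfl⟩
      refine ⟨⟨y, hy, rfl⟩, ?_⟩
      change Φ y 0 < _
      rw [hΦ0]
      exact hy0
  have h3 := H ε h1 h2
  rwa [hcrop, vol_image_linearIsometryEquiv, vol_image_linearIsometryEquiv,
    perim_image_linearIsometryEquiv, perim_image_linearIsometryEquiv] at h3
end
end

section
/- Let d ≥ 1, let K ⊂ ℝ^d be a bounded convex set with nonempty interior, and let h : K → ℝ be a nonnegative concave function whose supremum ε = sup_K h is attained at some interior point. Then ∫_K h(y) dy ≥ ε · L^d(K)/(d+1); in particular, with d = n−1, ∫_K h ≥ ε · L^{n-1}(K)/n, where L^d denotes d-dimensional Lebesgue measure. -/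
open MeasureTheory Metric Set Real Bornology

noncomputable section

section Concave

variable {E : Type*} [NormedAddCommGroup E] [NormedSpace ℝ E] {K : Set E} {h : E → ℝ} {x : E}

/-- A nonnegative concave function on a bounded convex set with an interior point is bounded
above. -/
theorem ConcaveOn.bddAbove_image_of_nonneg (hconc : ConcaveOn ℝ K h) (hnonneg : ∀ y ∈ K, 0 ≤ h y)
    (hbd : IsBounded K) (hx : x ∈ interior K) : BddAbove (h '' K) := by
  obtain ⟨r, hr, hball⟩ := Metric.isOpen_iff.1 isOpen_interior x hx
  obtain ⟨R, hR, hKR⟩ := hbd.subset_ball_lt 0 x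
  set t : ℝ := r / R with ht
  have htpos : 0 < t := by positivity
  refine ⟨(1 + t) / t * h x, ?_⟩
  rintro _ ⟨y, hy, rfl⟩
  have hyR : ‖y - x‖ < R := by simpa [dist_eq_norm] using hKR hy
  have hz : x - t • (y - x) ∈ K := by
    apply interior_subset
    apply hball
    rw [mem_ball, dist_eq_norm]
    have : x - t • (y - x) - x = -(t • (y - x)) := by abel
    rw [this, norm_neg, norm_smul, Real.norm_of_nonneg htpos.le]
    calc t * ‖y - x‖ < t * R := by gcongr
      _ = r := by rw [ht]; field_simp
  have key := hconc.2 hy hz (show 0 ≤ t / (1 + t) by positivity)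
    (show 0 ≤ 1 / (1 + t) by positivity) (by field_simp; ring)
  have hcomb : (t / (1 + t)) • y + (1 / (1 + t)) • (x - t • (y - x)) = x := by
    match_scalars <;> field_simp <;> ring
  rw [hcomb] at key
  have hle : t / (1 + t) * h y ≤ h x := by
    have := mul_nonneg (show (0 : ℝ) ≤ 1 / (1 + t) by positivity) (hnonneg _ hz)
    simp only [smul_eq_mul] at key
    linarith
  rw [div_mul_eq_mul_div, div_le_iff₀ (by positivity)] at hle
  rw [div_mul_eq_mul_div, le_div_iff₀ htpos]
  linarith

/-- The superlevel set of a nonnegative concave function at height `s * h x` contains the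
homothetic copy of the domain with centre `x` and ratio `1 - s`. -/
theorem ConcaveOn.image_homothety_subset (hconc : ConcaveOn ℝ K h) (hnonneg : ∀ y ∈ K, 0 ≤ h y)
    (hx : x ∈ K) {s : ℝ} (hs₀ : 0 ≤ s) (hs₁ : s ≤ 1) :
    AffineMap.homothety x (1 - s) '' K ⊆ {y | s * h x ≤ h y} ∩ K := by
  rintro _ ⟨y, hy, rfl⟩
  have hcomb : AffineMap.homothety x (1 - s) y = s • x + (1 - s) • y := by
    simp only [AffineMap.homothety_apply, vsub_eq_sub, vadd_eq_add]
    module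
  rw [hcomb]
  refine ⟨?_, hconc.1 hx hy hs₀ (by linarith) (by ring)⟩
  have key := hconc.2 hx hy hs₀ (by linarith : 0 ≤ 1 - s) (by ring)
  have := mul_nonneg (by linarith : 0 ≤ 1 - s) (hnonneg y hy)
  simp only [smul_eq_mul] at key
  change s * h x ≤ h _
  linarith

theorem integral_one_sub_div_pow {ε : ℝ} (hε : ε ≠ 0) (d : ℕ) :
    ∫ t in (0 : ℝ)..ε, (1 - t / ε) ^ d = ε / (d + 1) := by
  rw [intervalIntegral.integral_comp_sub_div (fun u => u ^ d) hε]
  simp [hε, div_eq_mul_inv]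

variable [FiniteDimensional ℝ E] [MeasurableSpace E] [BorelSpace E] (μ : Measure E)
  [μ.IsAddHaarMeasure]

theorem ConcaveOn.integrableOn_of_bound (hconc : ConcaveOn ℝ K h) (hbd : IsBounded K) {C : ℝ}
    (hC : ∀ y ∈ K, ‖h y‖ ≤ C) : IntegrableOn h K μ := by
  have hint : interior K =ᵐ[μ] K := interior_ae_eq_of_null_frontier (hconc.1.addHaar_frontier μ)
  refine IntegrableOn.congr_set_ae ?_ hint.symm
  refine IntegrableOn.of_bound ((measure_mono interior_subset).trans_lt hbd.measure_lt_top)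
    (hconc.continuousOn_interior.aestronglyMeasurable measurableSet_interior) C ?_
  exact (ae_restrict_iff' measurableSet_interior).2
    (.of_forall fun y hy => hC y (interior_subset hy))

/-- The integral of a concave function on `K` which is nonnegative and maximal at `x` is at
least that of the cone function over `K` with apex `(x, h x)`. -/
theorem ConcaveOn.mul_measureReal_div_le_setIntegral (hconc : ConcaveOn ℝ K h)
    (hnonneg : ∀ y ∈ K, 0 ≤ h y) (hbd : IsBounded K) (hx : x ∈ K) (hmax : ∀ y ∈ K, h y ≤ h x) :
    h x * μ.real K / (Module.finrank ℝ E + 1) ≤ ∫ y in K, h y ∂μ := by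
  have hnull : NullMeasurableSet K μ := hconc.1.nullMeasurableSet μ
  have hKfin : μ K ≠ ⊤ := hbd.measure_lt_top.ne
  have : IsFiniteMeasure (μ.restrict K) := ⟨by simpa using hbd.measure_lt_top⟩
  rcases (hnonneg x hx).eq_or_lt with h0 | hpos
  · rw [← h0]
    simpa using setIntegral_nonneg_of_ae_restrict ((ae_restrict_iff'₀ hnull).2 (.of_forall hnonneg))
  have hi : IntegrableOn h K μ := hconc.integrableOn_of_bound μ hbd (C := h x) fun y hy => by
    rw [Real.norm_of_nonneg (hnonneg y hy)]; exact hmax y hy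
  rw [hi.integral_eq_integral_Ioc_meas_le
    ((ae_restrict_iff'₀ hnull).2 (.of_forall hnonneg))
    ((ae_restrict_iff'₀ hnull).2 (.of_forall hmax)),
    ← intervalIntegral.integral_of_le hpos.le]
  calc h x * μ.real K / (Module.finrank ℝ E + 1)
      = ∫ t in (0 : ℝ)..h x, (1 - t / h x) ^ Module.finrank ℝ E * μ.real K := by
        rw [intervalIntegral.integral_mul_const, integral_one_sub_div_pow hpos.ne']
        ring
    _ ≤ _ := by
        refine intervalIntegral.integral_mono_on hpos.le ?_ ?_ ?_
        · exact (by fun_prop : Continuous _).intervalIntegrable _ _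
        · refine AntitoneOn.intervalIntegrable fun s _ t _ hst => ?_
          exact measureReal_mono fun y (hy : t ≤ h y) => hst.trans hy
        · rintro t ⟨ht₀, ht₁⟩
          have hs₁ : t / h x ≤ 1 := (div_le_one hpos).2 ht₁
          have hsub := hconc.image_homothety_subset hnonneg hx (div_nonneg ht₀ hpos.le) hs₁
          rw [div_mul_cancel₀ _ hpos.ne'] at hsub
          have hm := measureReal_mono (μ := μ) hsub
            (measure_ne_top_of_subset inter_subset_right hKfin)
          rw [measureReal_def, Measure.addHaar_image_homothety, ENNReal.toReal_mul,
            ENNReal.toReal_ofReal (abs_nonneg _),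
            abs_of_nonneg (pow_nonneg (by linarith) _)] at hm
          refine hm.trans_eq ?_
          rw [measureReal_def, measureReal_def, Measure.restrict_apply₀' hnull]

end Concave

/-- a nonnegative concave function on a bounded convex body `K ⊂ ℝ^d`, whose
supremum `ε` is attained at an interior point, satisfies `∫_K h ≥ ε · L^d(K) / (d+1)`. -/
theorem concave_integral_cone_lower_bound (d : ℕ) (hd : 1 ≤ d)
    (K : Set (EuclideanSpace ℝ (Fin d)))
    (hbd : IsBounded K) (hconv : Convex ℝ K) (hint : (interior K).Nonempty)
    (h : EuclideanSpace ℝ (Fin d) → ℝ)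
    (hconc : ConcaveOn ℝ K h) (hnonneg : ∀ y ∈ K, 0 ≤ h y)
    (ε : ℝ) (hsup : ε = sSup (h '' K))
    (hatt : ∃ x ∈ interior K, h x = ε) :
    (∫ y in K, h y) ≥ ε * (volume K).toReal / (d + 1) := by
  obtain ⟨x, hx, rfl⟩ := hatt
  have hbdd := hconc.bddAbove_image_of_nonneg hnonneg hbd hx
  have hmax : ∀ y ∈ K, h y ≤ h x := fun y hy => hsup ▸ le_csSup hbdd (mem_image_of_mem h hy)
  have := hconc.mul_measureReal_div_le_setIntegral volume hnonneg hbd (interior_subset hx) hmax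
  simpa [measureReal_def] using this
end
end

section
/- Let h : ℝ → ℝ be a C², 2π-periodic function with h(θ) + h''(θ) > 0 for all θ. Define L = ∫₀^{2π} h(θ) dθ, A = (1/2)∫₀^{2π} (h(θ)² + h(θ)h''(θ)) dθ, and J = ∫₀^{2π} (h(θ)³ + (1/2)h(θ)²h''(θ)) dθ. Then πJ − LA ≥ (L/2)·∫₀^{2π} (h(θ) − L/(2π))² dθ ≥ 0, and πJ = LA if and only if h is constant. -/
open MeasureTheory Real

noncomputable section

theorem Function.Periodic.intervalIntegral_deriv_eq_zero {G G' : ℝ → ℝ} {T : ℝ}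
    (hp : Function.Periodic G T) (hG : ∀ x, HasDerivAt G (G' x) x) (hc : Continuous G') :
    ∫ x in (0:ℝ)..T, G' x = 0 := by
  rw [intervalIntegral.integral_eq_sub_of_hasDerivAt (fun x _ => hG x)
    (hc.intervalIntegrable _ _), ← zero_add T, hp 0, sub_self]

theorem integral_nonneg_of_eq_zero_endpoints {f f' : ℝ → ℝ} (hf : ∀ x, HasDerivAt f (f' x) x)
    (hc : Continuous f') (h0 : f 0 = 0) (h1 : f (2 * π) = 0) :
    0 ≤ ∫ x in (0:ℝ)..(2 * π), ((1 + cos x) * f' x ^ 2 - (1 + 2 * cos x) * f x ^ 2) := by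
  have hfc : Continuous f := continuous_iff_continuousAt.2 fun x => (hf x).continuousAt
  set g : ℝ → ℝ := fun x => f x ^ 2 * (cos x * (cos (x / 2) / sin (x / 2))) with hg
  have hspos : ∀ x ∈ Set.Ioo (0:ℝ) (2 * π), 0 < sin (x / 2) := fun x hx =>
    sin_pos_of_pos_of_lt_pi (by linarith [hx.1]) (by linarith [hx.2])
  have hsd : ∀ x, HasDerivAt (fun y : ℝ => sin (y / 2)) (cos (x / 2) * (1 / 2)) x := fun x =>
    ((hasDerivAt_id x).div_const 2).sin
  have hcd : ∀ x, HasDerivAt (fun y : ℝ => cos (y / 2)) (-sin (x / 2) * (1 / 2)) x := fun x =>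
    ((hasDerivAt_id x).div_const 2).cos
  have hend : ∀ x₀, f x₀ = 0 → sin (x₀ / 2) = 0 → ContinuousAt g x₀ := by
    intro x₀ hf0 hs0
    have hcos : cos (x₀ / 2) ≠ 0 := fun h => by
      have := sin_sq_add_cos_sq (x₀ / 2)
      rw [hs0, h] at this; norm_num at this
    have hO : f =O[nhds x₀] fun y => sin (y / 2) := by
      have h1 : f =O[nhds x₀] fun y => y - x₀ := by
        simpa [hf0] using (hf x₀).isBigO_sub
      have h2 : (fun y => y - x₀) =O[nhds x₀] fun y => sin (y / 2) := by
        have := ((hsd x₀).isTheta_sub (by simpa using hcos)).2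
        simpa [Function.comp_def, hs0] using this
      exact h1.trans h2
    have hgO : g =O[nhds x₀] f := by
      obtain ⟨C, hC⟩ := hO.bound
      refine Asymptotics.IsBigO.of_bound C ?_
      filter_upwards [hC] with y hy
      rcases eq_or_ne (sin (y / 2)) 0 with hs | hs
      · rw [hs, norm_zero, mul_zero, norm_le_zero_iff] at hy
        simp [hg, hy]
      · have e : g y = f y * (f y / sin (y / 2)) * (cos y * cos (y / 2)) := by
          simp only [hg]; ring
        rw [e, norm_mul, norm_mul]
        have a1 : ‖f y / sin (y / 2)‖ ≤ C := by
          rw [norm_div, div_le_iff₀ (norm_pos_iff.2 hs)]; exact hy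
        have a2 : ‖cos y * cos (y / 2)‖ ≤ 1 := by
          rw [norm_mul]
          exact mul_le_one₀ (abs_cos_le_one _) (norm_nonneg _) (abs_cos_le_one _)
        calc ‖f y‖ * ‖f y / sin (y / 2)‖ * ‖cos y * cos (y / 2)‖
            ≤ ‖f y‖ * ‖f y / sin (y / 2)‖ * 1 := by gcongr
          _ ≤ ‖f y‖ * C * 1 := by gcongr
          _ = C * ‖f y‖ := by ring
    have : g x₀ = 0 := by simp [hg, hf0]
    rw [ContinuousAt, this]
    exact hgO.trans_tendsto (hf0 ▸ hfc.tendsto x₀)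
  have hgc : ContinuousOn g (Set.Icc 0 (2 * π)) := by
    intro x hx
    rcases eq_or_lt_of_le hx.1 with rfl | hx0
    · exact (hend 0 h0 (by simp)).continuousWithinAt
    rcases eq_or_lt_of_le hx.2 with rfl | hx1
    · exact (hend _ h1 (by simp)).continuousWithinAt
    have := (hspos x ⟨hx0, hx1⟩).ne'
    refine ContinuousAt.continuousWithinAt ?_
    exact (hfc.continuousAt.pow 2).mul (continuous_cos.continuousAt.mul
      ((hcd x).continuousAt.div (hsd x).continuousAt this))
  have key := intervalIntegral.sub_le_integral_of_hasDeriv_right_of_le (g := g)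
    (g' := fun x => 2 * f x * f' x * (cos x * (cos (x / 2) / sin (x / 2))) +
      f x ^ 2 * (-sin x * (cos (x / 2) / sin (x / 2)) +
        cos x * ((-sin (x / 2) * (1 / 2) * sin (x / 2) -
          cos (x / 2) * (cos (x / 2) * (1 / 2))) / sin (x / 2) ^ 2)))
    (φ := fun x => (1 + cos x) * f' x ^ 2 - (1 + 2 * cos x) * f x ^ 2)
    (a := 0) (b := 2 * π) (by positivity) hgc
    (fun x hx => by
      have := ((hf x).pow 2).mul ((hasDerivAt_cos x).mul
        ((hcd x).div (hsd x) (hspos x hx).ne'))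
      refine (this.congr_deriv ?_).hasDerivWithinAt
      simp)
    ((by fun_prop : Continuous fun x =>
      (1 + cos x) * f' x ^ 2 - (1 + 2 * cos x) * f x ^ 2).integrableOn_Icc)
    (fun x hx => by
      have hs := (hspos x hx).ne'
      have e1 : cos x = 1 - 2 * sin (x / 2) ^ 2 := by
        have := cos_two_mul' (x / 2)
        rw [mul_div_cancel₀ x two_ne_zero, cos_sq'] at this
        linarith
      have e2 : sin x = 2 * sin (x / 2) * cos (x / 2) := by
        rw [← sin_two_mul]; ring_nf
      have e3 := sin_sq_add_cos_sq (x / 2)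
      rw [e1, e2]
      set S := sin (x / 2)
      set C := cos (x / 2)
      have e4 : C ^ 2 = 1 - S ^ 2 := by linarith
      have : 0 ≤ 2 * (C * f' x - f x * (1 - 2 * S ^ 2) / (2 * S)) ^ 2 := by positivity
      rw [← sub_nonneg]
      convert this using 1
      field_simp
      linear_combination (-4 * S ^ 2 * f' x ^ 2 + (2 * S ^ 2 + 1) * f x ^ 2) * e4)
  simpa [hg, h0, h1] using key

theorem integral_nonneg_of_integral_eq_zero {q q' : ℝ → ℝ} (hq : ∀ x, HasDerivAt q (q' x) x)
    (hc : Continuous q') (hp : Function.Periodic q (2 * π))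
    (hm : ∫ x in (0:ℝ)..(2 * π), q x = 0) :
    0 ≤ ∫ x in (0:ℝ)..(2 * π), ((1 + cos x) * q' x ^ 2 - (1 + 2 * cos x) * q x ^ 2) := by
  have hqc : Continuous q := continuous_iff_continuousAt.2 fun x => (hq x).continuousAt
  set b := q 0
  have hp0 : q (2 * π) = b := by simpa using hp 0
  have h1 := integral_nonneg_of_eq_zero_endpoints (f := fun x => q x - b * cos x)
    (f' := fun x => q' x + b * sin x)
    (fun x => ((hq x).sub ((hasDerivAt_cos x).const_mul b)).congr_deriv (by ring))
    (by fun_prop) (by simp [b]) (by simp [hp0])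
  have h2 := Function.Periodic.intervalIntegral_deriv_eq_zero (T := 2 * π)
    (G := fun x => 2 * b * ((1 + cos x) * sin x * q x) -
      b ^ 2 * (sin x * cos x + cos x ^ 2 * sin x + sin x))
    (G' := fun x => 2 * b * ((1 + cos x) * sin x * q' x +
        q x * (cos x + cos x ^ 2 - sin x ^ 2)) -
      b ^ 2 * (cos x ^ 2 - sin x ^ 2 + (cos x ^ 3 - 2 * cos x * sin x ^ 2) + cos x))
    (fun x => by simp [hp x])
    (fun x => by
      have hs := hasDerivAt_sin x
      have hcs := hasDerivAt_cos x
      refine ((((hcs.const_add 1).mul hs).mul (hq x)).const_mul (2 * b) |>.sub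
        ((((hs.mul hcs).add ((hcs.pow 2).mul hs)).add hs).const_mul (b ^ 2))).congr_deriv ?_
      simp
      ring)
    (by fun_prop)
  have h3 : ∫ x in (0:ℝ)..(2 * π), ((1 + cos x) * (q' x + b * sin x) ^ 2 -
      (1 + 2 * cos x) * (q x - b * cos x) ^ 2) =
      (∫ x in (0:ℝ)..(2 * π), ((1 + cos x) * q' x ^ 2 - (1 + 2 * cos x) * q x ^ 2)) +
      (∫ x in (0:ℝ)..(2 * π), (2 * b * ((1 + cos x) * sin x * q' x +
        q x * (cos x + cos x ^ 2 - sin x ^ 2)) -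
      b ^ 2 * (cos x ^ 2 - sin x ^ 2 + (cos x ^ 3 - 2 * cos x * sin x ^ 2) + cos x))) +
      2 * b * ∫ x in (0:ℝ)..(2 * π), q x := by
    rw [← intervalIntegral.integral_const_mul, ← intervalIntegral.integral_add,
      ← intervalIntegral.integral_add]
    · refine intervalIntegral.integral_congr fun x _ => ?_
      simp only [sin_sq]
      linear_combination (b ^ 2 * (1 + cos x)) * sin_sq_add_cos_sq x
    all_goals exact Continuous.intervalIntegrable (by fun_prop) _ _
  rw [h3, h2, hm] at h1
  simpa using h1

theorem Function.Periodic.intervalIntegral_comp_add_eq {f : ℝ → ℝ} {T : ℝ}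
    (hp : Function.Periodic f T) (s : ℝ) :
    ∫ x in (0:ℝ)..T, f (x + s) = ∫ x in (0:ℝ)..T, f x := by
  simpa [add_comm T s] using hp.intervalIntegral_add_eq s 0

theorem integral_trig_mul_le_of_integral_eq_zero {q q' : ℝ → ℝ}
    (hq : ∀ x, HasDerivAt q (q' x) x) (hc : Continuous q')
    (hp : Function.Periodic q (2 * π)) (hp' : Function.Periodic q' (2 * π))
    (hm : ∫ x in (0:ℝ)..(2 * π), q x = 0) (u v : ℝ) :
    ∫ x in (0:ℝ)..(2 * π), (u * cos x + v * sin x) * (q' x ^ 2 - 2 * q x ^ 2) ≤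
      √(u ^ 2 + v ^ 2) * ∫ x in (0:ℝ)..(2 * π), (q' x ^ 2 - q x ^ 2) := by
  have hqc : Continuous q := continuous_iff_continuousAt.2 fun x => (hq x).continuousAt
  set t := √(u ^ 2 + v ^ 2) with ht
  obtain ⟨a, hu, hv⟩ : ∃ a, u = t * cos a ∧ v = t * sin a := by
    have hn : ‖(⟨u, v⟩ : ℂ)‖ = t := by
      rw [ht, Complex.norm_def, Complex.normSq_mk, sq, sq]
    refine ⟨Complex.arg ⟨u, v⟩, ?_, ?_⟩
    · rw [← hn, Complex.norm_mul_cos_arg]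
    · rw [← hn, Complex.norm_mul_sin_arg]
  have h1 := integral_nonneg_of_integral_eq_zero (q := fun x => q (x + (a + π)))
    (q' := fun x => q' (x + (a + π))) (fun x => (hq _).comp_add_const x _) (by fun_prop)
    (fun x => by simpa only [add_right_comm] using hp (x + (a + π)))
    (by rw [hp.intervalIntegral_comp_add_eq, hm])
  have h2 := Function.Periodic.intervalIntegral_comp_add_eq (T := 2 * π)
    (f := fun x => (1 - cos (x - a)) * q' x ^ 2 - (1 - 2 * cos (x - a)) * q x ^ 2)
    (fun x => by
      have : x + 2 * π - a = x - a + 2 * π := by ring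
      simp only [hp x, hp' x, this, cos_add_two_pi]) (a + π)
  have h3 : ∀ x, cos (x + (a + π) - a) = -cos x := fun x => by
    rw [← cos_add_pi]; ring_nf
  simp only [h3, mul_neg, sub_neg_eq_add] at h2
  rw [h2] at h1
  have h4 : t * (∫ x in (0:ℝ)..(2 * π), (q' x ^ 2 - q x ^ 2)) -
      ∫ x in (0:ℝ)..(2 * π), (u * cos x + v * sin x) * (q' x ^ 2 - 2 * q x ^ 2) =
      t * ∫ x in (0:ℝ)..(2 * π),
        ((1 - cos (x - a)) * q' x ^ 2 - (1 - 2 * cos (x - a)) * q x ^ 2) := by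
    rw [← intervalIntegral.integral_const_mul, ← intervalIntegral.integral_const_mul,
      ← intervalIntegral.integral_sub]
    · refine intervalIntegral.integral_congr fun x _ => ?_
      simp only [hu, hv, cos_sub]
      ring
    all_goals exact Continuous.intervalIntegrable (by fun_prop) _ _
  have h5 : 0 ≤ t := sqrt_nonneg _
  nlinarith [mul_nonneg h5 h1]

/-- The Steiner point of a convex set belongs to it, expressed via the support function. -/
theorem integral_mul_cos_sub_le {h h' h'' : ℝ → ℝ} (hd : ∀ x, HasDerivAt h (h' x) x)
    (hd' : ∀ x, HasDerivAt h' (h'' x) x) (hc : Continuous h'')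
    (hp : Function.Periodic h (2 * π)) (hconv : ∀ x, 0 ≤ h x + h'' x) (y : ℝ) :
    ∫ x in (0:ℝ)..(2 * π), h x * cos (x - y) ≤ π * h y := by
  have hhc : Continuous h := continuous_iff_continuousAt.2 fun x => (hd x).continuousAt
  have h1 := intervalIntegral.integral_eq_sub_of_hasDerivAt (a := 0) (b := 2 * π)
    (f := fun x => h' (x + y) * (sin x * (π - x)) -
      h (x + y) * (cos x * (π - x) - sin x))
    (f' := fun x => (h (x + y) + h'' (x + y)) * (sin x * (π - x)) + 2 * (h (x + y) * cos x))
    (fun x _ => by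
      have hs := hasDerivAt_sin x
      have hcs := hasDerivAt_cos x
      have hl : HasDerivAt (fun x : ℝ => π - x) (-1) x := (hasDerivAt_id x).const_sub π
      refine ((((hd' _).comp_add_const x y).mul (hs.mul hl)).sub
        (((hd _).comp_add_const x y).mul ((hcs.mul hl).sub hs))).congr_deriv ?_
      simp
      ring)
    (Continuous.intervalIntegrable (by fun_prop) _ _)
  have h2 : 0 ≤ ∫ x in (0:ℝ)..(2 * π), (h (x + y) + h'' (x + y)) * (sin x * (π - x)) := by
    refine intervalIntegral.integral_nonneg (by positivity) fun x hx => ?_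
    refine mul_nonneg (hconv _) ?_
    rcases le_total x π with hx' | hx'
    · exact mul_nonneg (sin_nonneg_of_nonneg_of_le_pi hx.1 hx') (by linarith)
    · refine mul_nonneg_of_nonpos_of_nonpos ?_ (by linarith)
      rw [← sin_sub_two_pi]
      exact sin_nonpos_of_nonpos_of_neg_pi_le (by linarith [hx.2]) (by linarith)
  rw [intervalIntegral.integral_add (Continuous.intervalIntegrable (by fun_prop) _ _)
    (Continuous.intervalIntegrable (by fun_prop) _ _),
    intervalIntegral.integral_const_mul] at h1
  have h3 := Function.Periodic.intervalIntegral_comp_add_eq (T := 2 * π)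
    (f := fun x => h x * cos (x - y))
    (fun x => by
      have : x + 2 * π - y = x - y + 2 * π := by ring
      simp only [hp x, this, cos_add_two_pi]) y
  simp only [add_sub_cancel_right] at h3
  have h4 : h (2 * π + y) = h y := by rw [add_comm, hp]
  simp [h3, h4] at h1
  linarith

theorem integral_support_function_nonneg {h h' h'' : ℝ → ℝ} (hd : ∀ x, HasDerivAt h (h' x) x)
    (hd' : ∀ x, HasDerivAt h' (h'' x) x) (hc : Continuous h'')
    (hp : Function.Periodic h (2 * π)) (hp' : Function.Periodic h' (2 * π))
    (hconv : ∀ x, 0 ≤ h x + h'' x) (a : ℝ) (ha : ∫ x in (0:ℝ)..(2 * π), h x = 2 * π * a) :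
    0 ≤ ∫ x in (0:ℝ)..(2 * π), (h x ^ 3 + 1 / 2 * h x ^ 2 * h'' x -
      a * (h x ^ 2 + h x * h'' x) - a * (h x - a) ^ 2) := by
  have hhc : Continuous h := continuous_iff_continuousAt.2 fun x => (hd x).continuousAt
  have hhc' : Continuous h' := continuous_iff_continuousAt.2 fun x => (hd' x).continuousAt
  set u := (∫ x in (0:ℝ)..(2 * π), h x * cos x) / π with hu
  set v := (∫ x in (0:ℝ)..(2 * π), h x * sin x) / π with hv
  replace hu : ∫ x in (0:ℝ)..(2 * π), h x * cos x = π * u := by rw [hu]; field_simp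
  replace hv : ∫ x in (0:ℝ)..(2 * π), h x * sin x = π * v := by rw [hv]; field_simp
  set t := √(u ^ 2 + v ^ 2) with ht
  have ht2 : t ^ 2 = u ^ 2 + v ^ 2 := sq_sqrt (by positivity)
  set c : ℝ → ℝ := fun x => u * cos x + v * sin x with hcdef
  set c' : ℝ → ℝ := fun x => -u * sin x + v * cos x with hcdef'
  have hcd : ∀ x, HasDerivAt c (c' x) x := fun x =>
    (((hasDerivAt_cos x).const_mul u).add ((hasDerivAt_sin x).const_mul v)).congr_deriv (by
      simp [hcdef'])
  have hcd' : ∀ x, HasDerivAt c' (-c x) x := fun x =>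
    (((hasDerivAt_sin x).const_mul (-u)).add ((hasDerivAt_cos x).const_mul v)).congr_deriv (by
      simp only [hcdef]; ring)
  have hcc : ∀ x, c x ^ 2 + c' x ^ 2 = t ^ 2 := fun x => by
    rw [ht2]
    linear_combination (u ^ 2 + v ^ 2) * sin_sq_add_cos_sq x
  have hcp : Function.Periodic c (2 * π) := fun x => by simp [hcdef]
  have hcp' : Function.Periodic c' (2 * π) := fun x => by simp [hcdef']
  have hccont : Continuous c := by fun_prop
  have hccont' : Continuous c' := by fun_prop
  set q : ℝ → ℝ := fun x => h x - a - c x with hq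
  set q' : ℝ → ℝ := fun x => h' x - c' x with hq'
  set q'' : ℝ → ℝ := fun x => h'' x + c x with hq''
  have hqd : ∀ x, HasDerivAt q (q' x) x := fun x => ((hd x).sub_const a).sub (hcd x)
  have hqd' : ∀ x, HasDerivAt q' (q'' x) x := fun x =>
    ((hd' x).sub (hcd' x)).congr_deriv (by simp [hq''])
  have hqp : Function.Periodic q (2 * π) := fun x => by simp only [hq, hp x, hcp x]
  have hqp' : Function.Periodic q' (2 * π) := fun x => by simp only [hq', hp' x, hcp' x]
  have hqc : Continuous q := by fun_prop
  have hqc' : Continuous q' := by fun_prop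
  have hqc'' : Continuous q'' := by fun_prop
  have hc0 : ∫ x in (0:ℝ)..(2 * π), c x = 0 := by
    refine Function.Periodic.intervalIntegral_deriv_eq_zero (G := fun x => -c' x)
      (fun x => by simp only [hcp' x])
      (fun x => (hcd' x).neg.congr_deriv (neg_neg _)) hccont
  have hq0 : ∫ x in (0:ℝ)..(2 * π), q x = 0 := by
    rw [hq, intervalIntegral.integral_sub, intervalIntegral.integral_sub, ha, hc0]
    · simp
    all_goals exact Continuous.intervalIntegrable (by fun_prop) _ _
  have hhcint : ∫ x in (0:ℝ)..(2 * π), h x * c x = π * t ^ 2 := by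
    have : ∀ x, h x * c x = u * (h x * cos x) + v * (h x * sin x) := fun x => by
      simp only [hcdef]; ring
    simp only [this]
    rw [intervalIntegral.integral_add, intervalIntegral.integral_const_mul,
      intervalIntegral.integral_const_mul, hu, hv, ht2]
    · ring
    all_goals exact Continuous.intervalIntegrable (by fun_prop) _ _
  have hqcint : ∫ x in (0:ℝ)..(2 * π), q x * c x = 0 := by
    have h1 := Function.Periodic.intervalIntegral_deriv_eq_zero (T := 2 * π)
      (G := fun x => c x * c' x / 2) (G' := fun x => t ^ 2 / 2 - c x ^ 2)
      (fun x => by simp only [hcp x, hcp' x])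
      (fun x => (((hcd x).mul (hcd' x)).div_const 2).congr_deriv (by
        linear_combination hcc x / 2)) (by fun_prop)
    have h2 : ∀ x, q x * c x = h x * c x - a * c x + (t ^ 2 / 2 - c x ^ 2) - t ^ 2 / 2 :=
      fun x => by simp only [hq]; ring
    simp only [h2]
    rw [intervalIntegral.integral_sub, intervalIntegral.integral_add,
      intervalIntegral.integral_sub, intervalIntegral.integral_const_mul, h1, hhcint, hc0]
    · simp; ring
    all_goals exact Continuous.intervalIntegrable (by fun_prop) _ _
  have hsteiner : ∀ y, 0 ≤ a + q y := fun y => by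
    have h1 := integral_mul_cos_sub_le hd hd' hc hp hconv y
    have h2 : ∀ x, h x * cos (x - y) = cos y * (h x * cos x) + sin y * (h x * sin x) :=
      fun x => by rw [cos_sub]; ring
    simp only [h2] at h1
    rw [intervalIntegral.integral_add (Continuous.intervalIntegrable (by fun_prop) _ _)
      (Continuous.intervalIntegrable (by fun_prop) _ _), intervalIntegral.integral_const_mul,
      intervalIntegral.integral_const_mul, hu, hv] at h1
    have h3 : 0 ≤ π * (a + q y) := by
      simp only [hq, hcdef]; linarith
    exact nonneg_of_mul_nonneg_right h3 pi_pos
  have hwirt := integral_trig_mul_le_of_integral_eq_zero hqd hqc' hqp hqp' hq0 u v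
  have hG := Function.Periodic.intervalIntegral_deriv_eq_zero (T := 2 * π)
    (G := fun x => c x * (q x * q' x) - 1 / 2 * (c' x * q x ^ 2) +
      1 / 2 * (c x ^ 2 * q' x - 2 * (q x * (c x * c' x))) - 1 / 6 * (c x ^ 2 * c' x) -
      (t ^ 2 / 3 + 3 / 2 * a ^ 2) * c' x - a / 2 * (c x * c' x) - t * (q x * q' x) -
      (a ^ 2 + t ^ 2) / 2 * q' x)
    (G' := fun x => (c' x * (q x * q' x) + c x * (q' x ^ 2 + q x * q'' x)) -
      1 / 2 * (-c x * q x ^ 2 + c' x * (2 * q x * q' x)) +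
      1 / 2 * (2 * c x * c' x * q' x + c x ^ 2 * q'' x -
        2 * (q' x * (c x * c' x) + q x * (c' x ^ 2 - c x ^ 2))) -
      1 / 6 * (2 * c x * c' x ^ 2 - c x ^ 3) +
      (t ^ 2 / 3 + 3 / 2 * a ^ 2) * c x - a / 2 * (c' x ^ 2 - c x ^ 2) -
      t * (q' x ^ 2 + q x * q'' x) - (a ^ 2 + t ^ 2) / 2 * q'' x)
    (fun x => by simp only [hcp x, hcp' x, hqp x, hqp' x])
    (fun x => by
      have hcc' := (hcd x).mul (hcd' x)
      have hqq' := (hqd x).mul (hqd' x)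
      refine (((((((((hcd x).mul hqq').sub (((hcd' x).mul ((hqd x).pow 2)).const_mul (1 / 2))).add
        (((((hcd x).pow 2).mul (hqd' x)).sub
          (((hqd x).mul hcc').const_mul 2)).const_mul (1 / 2))).sub
        ((((hcd x).pow 2).mul (hcd' x)).const_mul (1 / 6))).sub
        ((hcd' x).const_mul (t ^ 2 / 3 + 3 / 2 * a ^ 2))).sub
        (hcc'.const_mul (a / 2))).sub (hqq'.const_mul t)).sub
        ((hqd' x).const_mul ((a ^ 2 + t ^ 2) / 2))).congr_deriv ?_
      simp
      ring)
    (by fun_prop)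
  set G' : ℝ → ℝ := fun x => (c' x * (q x * q' x) + c x * (q' x ^ 2 + q x * q'' x)) -
      1 / 2 * (-c x * q x ^ 2 + c' x * (2 * q x * q' x)) +
      1 / 2 * (2 * c x * c' x * q' x + c x ^ 2 * q'' x -
        2 * (q' x * (c x * c' x) + q x * (c' x ^ 2 - c x ^ 2))) -
      1 / 6 * (2 * c x * c' x ^ 2 - c x ^ 3) +
      (t ^ 2 / 3 + 3 / 2 * a ^ 2) * c x - a / 2 * (c' x ^ 2 - c x ^ 2) -
      t * (q' x ^ 2 + q x * q'' x) - (a ^ 2 + t ^ 2) / 2 * q'' x with hG'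
  have hGc : Continuous G' := by fun_prop
  have hlow : ∫ x in (0:ℝ)..(2 * π), (t * (q' x ^ 2 - q x ^ 2) -
      c x * (q' x ^ 2 - 2 * q x ^ 2) + G' x + 2 * a * (q x * c x) +
      (t ^ 2 / 2 + a ^ 2 - t * a) * q x) =
      t * (∫ x in (0:ℝ)..(2 * π), (q' x ^ 2 - q x ^ 2)) -
      ∫ x in (0:ℝ)..(2 * π), c x * (q' x ^ 2 - 2 * q x ^ 2) := by
    rw [intervalIntegral.integral_add, intervalIntegral.integral_add,
      intervalIntegral.integral_add, intervalIntegral.integral_sub,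
      intervalIntegral.integral_const_mul, intervalIntegral.integral_const_mul,
      intervalIntegral.integral_const_mul, hG, hqcint, hq0]
    · ring
    all_goals exact Continuous.intervalIntegrable (by fun_prop) _ _
  refine (sub_nonneg.2 hwirt).trans (hlow.symm.le.trans ?_)
  refine intervalIntegral.integral_mono_on (by positivity)
    (Continuous.intervalIntegrable (by fun_prop) _ _)
    (Continuous.intervalIntegrable (by fun_prop) _ _) fun x _ => ?_
  have hh : h x = a + c x + q x := by simp only [hq]; ring
  have hh'' : h'' x = q'' x - c x := by simp only [hq'']; ring
  have hρ : 0 ≤ a + q x + q'' x := by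
    have := hconv x
    rw [hh, hh''] at this; linarith
  have hpos : 0 ≤ 1 / 2 * ((q x + t) ^ 2 * (a + q x + q'' x)) + 1 / 2 * (q x ^ 2 * (a + q x)) := by
    have := hsteiner x
    positivity
  rw [hh, hh'', ← sub_nonneg]
  refine hpos.trans_eq ?_
  simp only [hG']
  linear_combination (-(q x + a / 2 + c x / 3)) * hcc x


/-- Weinstock's two-dimensional inequality via support functions:
for a `C²`, `2π`-periodic function `h` with `h + h'' > 0`, setting
`L = ∫₀^{2π} h`, `A = ½∫₀^{2π} (h² + h h'')` and `J = ∫₀^{2π} (h³ + ½ h² h'')`, one has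
`πJ - LA ≥ (L/2)∫₀^{2π} (h - L/(2π))² ≥ 0`, with `πJ = LA` iff `h` is constant. -/
theorem weinstock_2d_support_function (h : ℝ → ℝ) (hsm : ContDiff ℝ 2 h)
    (hper : Function.Periodic h (2 * π))
    (hconv : ∀ θ : ℝ, 0 < h θ + deriv (deriv h) θ) :
    (π * (∫ θ in (0:ℝ)..(2 * π), (h θ ^ 3 + (1 / 2) * h θ ^ 2 * deriv (deriv h) θ)) -
        (∫ θ in (0:ℝ)..(2 * π), h θ) *
          ((1 / 2) * ∫ θ in (0:ℝ)..(2 * π), (h θ ^ 2 + h θ * deriv (deriv h) θ)) ≥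
      (∫ θ in (0:ℝ)..(2 * π), h θ) / 2 *
        ∫ θ in (0:ℝ)..(2 * π), (h θ - (∫ θ in (0:ℝ)..(2 * π), h θ) / (2 * π)) ^ 2) ∧
    (0 ≤ (∫ θ in (0:ℝ)..(2 * π), h θ) / 2 *
        ∫ θ in (0:ℝ)..(2 * π), (h θ - (∫ θ in (0:ℝ)..(2 * π), h θ) / (2 * π)) ^ 2) ∧
    (π * (∫ θ in (0:ℝ)..(2 * π), (h θ ^ 3 + (1 / 2) * h θ ^ 2 * deriv (deriv h) θ)) =
        (∫ θ in (0:ℝ)..(2 * π), h θ) *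
          ((1 / 2) * ∫ θ in (0:ℝ)..(2 * π), (h θ ^ 2 + h θ * deriv (deriv h) θ)) ↔
      ∃ c : ℝ, ∀ θ : ℝ, h θ = c) := by
  have hd : ∀ x, HasDerivAt h (deriv h x) x := fun x =>
    (hsm.differentiable two_ne_zero x).hasDerivAt
  have hsm' : ContDiff ℝ 1 (deriv h) := hsm.deriv'
  have hd' : ∀ x, HasDerivAt (deriv h) (deriv (deriv h) x) x := fun x =>
    (hsm'.differentiable one_ne_zero x).hasDerivAt
  have hc' : Continuous (deriv (deriv h)) := hsm'.continuous_deriv le_rfl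
  have hc : Continuous h := hsm.continuous
  have hper' : Function.Periodic (deriv h) (2 * π) := fun x => by
    rw [← deriv_comp_add_const, show (fun x => h (x + 2 * π)) = h from funext hper]
  have hL : 0 < ∫ θ in (0:ℝ)..(2 * π), h θ := by
    have h1 : 0 < ∫ θ in (0:ℝ)..(2 * π), (h θ + deriv (deriv h) θ) :=
      intervalIntegral.intervalIntegral_pos_of_pos
        (Continuous.intervalIntegrable (by fun_prop) _ _) hconv (by positivity)
    rwa [intervalIntegral.integral_add (hc.intervalIntegrable _ _) (hc'.intervalIntegrable _ _),
      hper'.intervalIntegral_deriv_eq_zero hd' hc', add_zero] at h1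
  set L := ∫ θ in (0:ℝ)..(2 * π), h θ
  have hmain := integral_support_function_nonneg hd hd' hc' hper hper' (fun x => (hconv x).le)
    (L / (2 * π)) (mul_div_cancel₀ L two_pi_pos.ne').symm
  rw [intervalIntegral.integral_sub, intervalIntegral.integral_sub,
    intervalIntegral.integral_const_mul, intervalIntegral.integral_const_mul] at hmain
  rotate_left
  iterate 4 exact Continuous.intervalIntegrable (by fun_prop) _ _
  set A := ∫ θ in (0:ℝ)..(2 * π), (h θ ^ 2 + h θ * deriv (deriv h) θ)
  set J := ∫ θ in (0:ℝ)..(2 * π), (h θ ^ 3 + 1 / 2 * h θ ^ 2 * deriv (deriv h) θ)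
  set D := ∫ θ in (0:ℝ)..(2 * π), (h θ - L / (2 * π)) ^ 2
  have hDnonneg : 0 ≤ D := intervalIntegral.integral_nonneg (by positivity) fun _ _ => sq_nonneg _
  have hineq : L / 2 * D ≤ π * J - L * (1 / 2 * A) := by
    have h1 := mul_nonneg pi_pos.le hmain
    have h2 : π * (J - L / (2 * π) * A - L / (2 * π) * D) =
        π * J - L * (1 / 2 * A) - L / 2 * D := by field_simp
    linarith
  refine ⟨hineq, by positivity, fun heq => ⟨L / (2 * π), fun θ => ?_⟩, fun ⟨c, hconst⟩ => ?_⟩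
  · by_contra hne
    obtain ⟨y, hy, hθ⟩ := hper.exists_mem_Ico₀ two_pi_pos θ
    have hDpos : 0 < D := intervalIntegral.integral_pos two_pi_pos (by fun_prop)
      (fun _ _ => sq_nonneg _)
      ⟨y, Set.Ico_subset_Icc_self hy, by
        rw [← hθ]
        exact sq_pos_of_ne_zero (sub_ne_zero.2 hne)⟩
    have : 0 < L / 2 * D := by positivity
    linarith
  · obtain rfl : h = fun _ => c := funext hconst
    simp [L, A, J]
    ring
end
end

section
/- For every γ > 0 there exists a bounded open convex set Ω ⊂ ℝ² (one may take a regular polygon with sufficiently many sides, inradius 1, centered at the origin) such that W(Ω) / (P(Ω)^{1+γ} · V(Ω)^{1−γ/2}) < 2^{−γ} π^{−(1+γ/2)}, the right-hand side being the value of this functional on any disc centered at the origin. Hence for γ > 0 discs do not minimize the functional λ_γ(Ω) = W(Ω)/(P(Ω)^{1+γ} V(Ω)^{1−γ/2}) among bounded open convex planar sets. -/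
open MeasureTheory Metric Set Real Bornology

noncomputable section

/-- The `x`-coordinate in the orthonormal frame of the plane rotated by the angle `φ`. -/
def dirCoord (φ : ℝ) : EuclideanSpace ℝ (Fin 2) →L[ℝ] ℝ :=
  cos φ • EuclideanSpace.proj 0 + sin φ • EuclideanSpace.proj 1

lemma dirCoord_apply (φ : ℝ) (x : EuclideanSpace ℝ (Fin 2)) :
    dirCoord φ x = cos φ * x 0 + sin φ * x 1 := by
  simp [dirCoord]

lemma dirCoord_add (φ ψ : ℝ) (x : EuclideanSpace ℝ (Fin 2)) :
    dirCoord (φ + ψ) x = cos ψ * dirCoord φ x + sin ψ * dirCoord (φ + π / 2) x := by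
  simp only [dirCoord_apply, cos_add, sin_add, cos_pi_div_two, sin_pi_div_two]
  ring

lemma dirCoord_sq_add_sq (φ : ℝ) (x : EuclideanSpace ℝ (Fin 2)) :
    dirCoord φ x ^ 2 + dirCoord (φ + π / 2) x ^ 2 = ‖x‖ ^ 2 := by
  simp only [dirCoord_apply, EuclideanSpace.norm_sq_eq, Fin.sum_univ_two, norm_eq_abs, sq_abs,
    cos_add_pi_div_two, sin_add_pi_div_two]
  linear_combination (x 0 ^ 2 + x 1 ^ 2) * sin_sq_add_cos_sq φ

/-- The point with coordinates `(a, b)` in the frame rotated by `φ`. -/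
def framePoint (φ a b : ℝ) : EuclideanSpace ℝ (Fin 2) :=
  !₂[a * cos φ - b * sin φ, a * sin φ + b * cos φ]

lemma dirCoord_framePoint (φ a b : ℝ) : dirCoord φ (framePoint φ a b) = a := by
  simp only [dirCoord_apply, framePoint, Matrix.cons_val_zero,
    Matrix.cons_val_one, Matrix.cons_val_fin_one]
  linear_combination a * sin_sq_add_cos_sq φ

lemma dirCoord_perp_framePoint (φ a b : ℝ) :
    dirCoord (φ + π / 2) (framePoint φ a b) = b := by
  simp only [dirCoord_apply, framePoint, Matrix.cons_val_zero,
    Matrix.cons_val_one, Matrix.cons_val_fin_one, cos_add_pi_div_two, sin_add_pi_div_two]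
  linear_combination b * sin_sq_add_cos_sq φ

lemma framePoint_dirCoord (φ : ℝ) (x : EuclideanSpace ℝ (Fin 2)) :
    framePoint φ (dirCoord φ x) (dirCoord (φ + π / 2) x) = x := by
  ext i
  fin_cases i
  · simp [dirCoord_apply, framePoint, cos_add_pi_div_two, sin_add_pi_div_two]
    linear_combination x 0 * sin_sq_add_cos_sq φ
  · simp [dirCoord_apply, framePoint, cos_add_pi_div_two, sin_add_pi_div_two]
    linear_combination x 1 * sin_sq_add_cos_sq φ

lemma norm_framePoint_sq (φ a b : ℝ) : ‖framePoint φ a b‖ ^ 2 = a ^ 2 + b ^ 2 := by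
  rw [← dirCoord_sq_add_sq φ, dirCoord_framePoint, dirCoord_perp_framePoint]

lemma isometry_framePoint (φ a : ℝ) : Isometry (framePoint φ a) := by
  refine Isometry.of_dist_eq fun s s' => ?_
  have h : framePoint φ a s - framePoint φ a s' = framePoint φ 0 (s - s') := by
    ext i
    fin_cases i
    · simp [framePoint]; ring
    · simp [framePoint]; ring
  rw [dist_eq_norm, h, Real.dist_eq, ← abs_norm, ← sq_eq_sq_iff_abs_eq_abs, norm_framePoint_sq]
  ring

lemma measurePreserving_dirCoord_prod (φ : ℝ) :
    MeasurePreserving (fun x => (dirCoord φ x, dirCoord (φ + π / 2) x)) := by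
  let f : EuclideanSpace ℝ (Fin 2) →ₗ[ℝ] EuclideanSpace ℝ (Fin 2) :=
    { toFun := fun x => !₂[dirCoord φ x, dirCoord (φ + π / 2) x]
      map_add' := fun x y => by ext i; fin_cases i <;> simp
      map_smul' := fun c x => by ext i; fin_cases i <;> simp }
  have hf : ∀ x, ‖f x‖ = ‖x‖ := fun x => by
    rw [← abs_norm, ← abs_norm x, ← sq_eq_sq_iff_abs_eq_abs, ← dirCoord_sq_add_sq φ x,
      EuclideanSpace.norm_sq_eq]
    simp [f]
  let e := (LinearIsometry.mk f hf).toLinearIsometryEquiv rfl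
  exact (volume_preserving_finTwoArrow ℝ).comp
    ((PiLp.volume_preserving_ofLp (Fin 2)).comp e.measurePreserving)

lemma measurableSet_cone (t : ℝ) :
    MeasurableSet {p : ℝ × ℝ | p.1 < 1 ∧ |p.2| ≤ p.1 * t} := by
  refine MeasurableSet.inter (s₁ := {p : ℝ × ℝ | p.1 < 1})
    (s₂ := {p : ℝ × ℝ | |p.2| ≤ p.1 * t}) ?_ ?_
  · exact measurableSet_lt (by fun_prop) (by fun_prop)
  · exact measurableSet_le (by fun_prop) (by fun_prop)

lemma volume_cone (t : ℝ) (ht : 0 < t) :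
    volume {p : ℝ × ℝ | p.1 < 1 ∧ |p.2| ≤ p.1 * t} = ENNReal.ofReal t := by
  rw [Measure.volume_eq_prod, Measure.prod_apply (measurableSet_cone t)]
  have h : ∀ a : ℝ, volume (Prod.mk a ⁻¹' {p : ℝ × ℝ | p.1 < 1 ∧ |p.2| ≤ p.1 * t}) =
      (Ioo 0 1).indicator (fun a => ENNReal.ofReal (2 * t * a)) a := by
    intro a
    by_cases ha : a < 1
    · have : Prod.mk a ⁻¹' {p : ℝ × ℝ | p.1 < 1 ∧ |p.2| ≤ p.1 * t} = Icc (-(a * t)) (a * t) := by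
        ext b
        simp [ha, abs_le]
      rw [this, Real.volume_Icc]
      by_cases h0 : 0 < a
      · rw [indicator_of_mem (mem_Ioo.2 ⟨h0, ha⟩)]
        congr 1
        ring
      · rw [indicator_of_notMem (fun h => h0 h.1), ENNReal.ofReal_eq_zero]
        nlinarith
    · have : Prod.mk a ⁻¹' {p : ℝ × ℝ | p.1 < 1 ∧ |p.2| ≤ p.1 * t} = ∅ := by
        ext b
        simp [ha]
      rw [this, indicator_of_notMem (fun h => ha h.2), measure_empty]
  simp_rw [h]
  rw [lintegral_indicator measurableSet_Ioo, ← ofReal_integral_eq_lintegral_ofReal]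
  · rw [← integral_Ioc_eq_integral_Ioo, ← intervalIntegral.integral_of_le zero_le_one,
      intervalIntegral.integral_const_mul, integral_id]
    congr 1
    ring
  · exact (Continuous.integrableOn_Icc (by fun_prop)).mono_set Ioo_subset_Icc_self
  · filter_upwards [ae_restrict_mem measurableSet_Ioo] with a ha
    have := ha.1
    exact mul_nonneg (by positivity) this.le

/-- The direction of the `m`-th normal of the regular `n`-gon. -/
def normalAngle (n : ℕ) (m : ℤ) : ℝ := 2 * (m * (π / n))

lemma pi_div_lt_pi_div_two {n : ℕ} (hn : 3 ≤ n) : π / n < π / 2 := by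
  have : (3 : ℝ) ≤ n := by exact_mod_cast hn
  gcongr
  linarith

lemma tan_pi_div_pos {n : ℕ} (hn : 3 ≤ n) : 0 < tan (π / n) := by
  have : 0 < n := by omega
  exact tan_pos_of_pos_of_lt_pi_div_two (by positivity) (pi_div_lt_pi_div_two hn)

lemma cos_pi_div_pos {n : ℕ} (hn : 3 ≤ n) : 0 < cos (π / n) := by
  have : 0 < n := by omega
  have : 0 < π / n := by positivity
  exact cos_pos_of_mem_Ioo ⟨by linarith [pi_pos], pi_div_lt_pi_div_two hn⟩

lemma sin_int_mul_pi_div {n : ℕ} (hn : 3 ≤ n) (m : ℤ) :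
    sin (m * (π / n)) = 0 ∨ sin (π / n) ^ 2 ≤ sin (m * (π / n)) ^ 2 := by
  have hn0 : (0 : ℝ) < n := by exact_mod_cast (by omega : 0 < n)
  have hnz : (0 : ℤ) < n := by omega
  have hm : (m : ℝ) * (π / n) = ((m % n : ℤ) : ℝ) * (π / n) + ((m / n : ℤ) : ℝ) * π := by
    have : (m : ℝ) = ((m % n : ℤ) : ℝ) + n * ((m / n : ℤ) : ℝ) := by
      exact_mod_cast (Int.emod_add_mul_ediv m n).symm
    field_simp
    linarith
  have h0 := Int.emod_nonneg m hnz.ne'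
  have h1 := Int.emod_lt_of_pos m hnz
  generalize m % n = r at *
  rw [hm, sin_add_int_mul_pi]
  rcases h0.eq_or_lt with h | h
  · left; simp [← h]
  right
  have hsgn : ((-1 : ℝ) ^ (m / (n : ℤ))) ^ 2 = 1 := by
    rw [← sq_abs]
    simp
  rw [mul_pow, hsgn, one_mul]
  have hθ : 0 < π / n := by positivity
  have hlt := pi_div_lt_pi_div_two hn
  have hr1 : (1 : ℝ) ≤ r := by exact_mod_cast h
  have hr2 : (r : ℝ) + 1 ≤ n := by exact_mod_cast h1
  have e : n * (π / n) = π := by field_simp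
  have hsin : sin (π / n) ≤ sin (r * (π / n)) := by
    rcases le_total (r * (π / n)) (π / 2) with h2 | h2
    · apply sin_le_sin_of_le_of_le_pi_div_two <;> nlinarith
    · rw [← sin_pi_sub (r * (π / n))]
      apply sin_le_sin_of_le_of_le_pi_div_two <;> nlinarith
  have : 0 ≤ sin (π / n) := sin_nonneg_of_nonneg_of_le_pi hθ.le (by linarith)
  exact pow_le_pow_left₀ this hsin 2

lemma sin_sub_mul_pi_div_ne_zero {n : ℕ} {j k : Fin n} (h : j ≠ k) :
    sin ((((j : ℕ) : ℤ) - ((k : ℕ) : ℤ) : ℤ) * (π / n)) ≠ 0 := by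
  intro h0
  obtain ⟨i, hi⟩ := sin_eq_zero_iff.1 h0
  have hn : (n : ℝ) ≠ 0 := by exact_mod_cast (by omega : n ≠ 0)
  have h1 : (i : ℝ) * n = (((j : ℕ) : ℤ) - ((k : ℕ) : ℤ) : ℤ) := by
    refine mul_right_cancel₀ pi_ne_zero ?_
    rw [mul_right_comm, hi]
    field_simp
  have h2 : i * n = ((j : ℕ) : ℤ) - ((k : ℕ) : ℤ) := by exact_mod_cast h1
  have h3 : ((j : ℕ) : ℤ) - ((k : ℕ) : ℤ) = 0 :=
    Int.eq_zero_of_abs_lt_dvd (m := n) ⟨i, by rw [← h2, mul_comm]⟩ (by rw [abs_lt]; omega)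
  exact h (Fin.ext (by omega))

lemma exists_dirCoord_normalAngle_eq {n : ℕ} (hn : 3 ≤ n) (m : ℤ) :
    ∃ j : Fin n, dirCoord (normalAngle n m) = dirCoord (normalAngle n (j : ℕ)) := by
  have hnz : (0 : ℤ) < n := by omega
  have hn0 : (0 : ℝ) < n := by exact_mod_cast (by omega : 0 < n)
  have h0 := Int.emod_nonneg m hnz.ne'
  have h1 := Int.emod_lt_of_pos m hnz
  refine ⟨⟨(m % n).toNat, by omega⟩, ?_⟩
  have hm : normalAngle n m = normalAngle n ((m % n).toNat : ℕ) + ((m / n : ℤ) : ℝ) * (2 * π) := by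
    rw [Int.toNat_of_nonneg h0]
    have : (m : ℝ) = ((m % n : ℤ) : ℝ) + n * ((m / n : ℤ) : ℝ) := by
      exact_mod_cast (Int.emod_add_mul_ediv m n).symm
    simp only [normalAngle]
    field_simp
    linarith
  ext x
  rw [hm, dirCoord_apply, dirCoord_apply, cos_add_int_mul_two_pi, sin_add_int_mul_two_pi]

/-- The cone over the `k`-th side of the regular polygon, in the rotated frame. -/
lemma forall_dirCoord_le_iff {n : ℕ} (hn : 3 ≤ n) (k : Fin n) (x : EuclideanSpace ℝ (Fin 2)) :
    (∀ j : Fin n, dirCoord (normalAngle n (j : ℕ)) x ≤ dirCoord (normalAngle n (k : ℕ)) x) ↔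
      |dirCoord (normalAngle n (k : ℕ) + π / 2) x| ≤
        dirCoord (normalAngle n (k : ℕ)) x * tan (π / n) := by
  have hrot : ∀ m : ℤ, dirCoord (normalAngle n m) x =
      cos (2 * ((m - (k : ℕ) : ℤ) * (π / n))) * dirCoord (normalAngle n (k : ℕ)) x +
      sin (2 * ((m - (k : ℕ) : ℤ) * (π / n))) * dirCoord (normalAngle n (k : ℕ) + π / 2) x := by
    intro m
    rw [← dirCoord_add]
    congr 2
    simp only [normalAngle]
    push_cast
    ring
  have hc := cos_pi_div_pos hn
  have ht := tan_pi_div_pos hn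
  have hs : sin (π / n) = tan (π / n) * cos (π / n) := (tan_mul_cos hc.ne').symm
  constructor
  · intro h
    have key : ∀ m : ℤ, dirCoord (normalAngle n m) x ≤ dirCoord (normalAngle n (k : ℕ)) x := by
      intro m
      obtain ⟨j, hj⟩ := exists_dirCoord_normalAngle_eq hn m
      rw [hj]
      exact h j
    have h1 := key ((k : ℕ) + 1)
    have h2 := key ((k : ℕ) - 1)
    rw [hrot] at h1 h2
    generalize dirCoord (normalAngle n (k : ℕ)) x = a at *
    generalize dirCoord (normalAngle n (k : ℕ) + π / 2) x = b at *
    have e1 : (((k : ℕ) + 1 - (k : ℕ) : ℤ) : ℝ) * (π / n) = π / n := by push_cast; ring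
    have e2 : (((k : ℕ) - 1 - (k : ℕ) : ℤ) : ℝ) * (π / n) = -(π / n) := by push_cast; ring
    rw [e1, cos_two_mul, sin_two_mul] at h1
    rw [e2, cos_two_mul, sin_two_mul, cos_neg, sin_neg] at h2
    have hsc := sin_sq_add_cos_sq (π / n)
    rw [hs] at h1 h2 hsc
    generalize cos (π / n) = c at *
    generalize tan (π / n) = t at *
    have hpos : 0 < 2 * t * c ^ 2 := by positivity
    rw [abs_le]
    constructor
    · refine le_of_mul_le_mul_left ?_ hpos
      linear_combination h2 - 2 * a * hsc
    · refine le_of_mul_le_mul_left ?_ hpos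
      linear_combination h1 - 2 * a * hsc
  · intro h j
    rw [hrot (j : ℕ)]
    have hα := sin_int_mul_pi_div hn ((j : ℕ) - (k : ℕ))
    generalize (((j : ℕ) - (k : ℕ) : ℤ) : ℝ) * (π / n) = α at *
    generalize dirCoord (normalAngle n (k : ℕ)) x = a at *
    generalize dirCoord (normalAngle n (k : ℕ) + π / 2) x = b at *
    have hsα := sin_sq_add_cos_sq α
    rw [cos_two_mul, sin_two_mul]
    rcases hα with h0 | h0
    · rw [h0] at hsα ⊢
      have : cos α ^ 2 = 1 := by linarith
      rw [this]
      linarith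
    have hsc := sin_sq_add_cos_sq (π / n)
    rw [hs] at h0 hsc
    generalize cos (π / n) = c at *
    generalize tan (π / n) = t at *
    have ha : 0 ≤ a := by
      have := (abs_nonneg b).trans h
      exact nonneg_of_mul_nonneg_left this ht
    have h1 : t * |cos α| ≤ |sin α| := by
      apply abs_le_of_sq_le_sq' _ (abs_nonneg _) |>.2
      rw [mul_pow, sq_abs, sq_abs]
      have hc2 : cos α ^ 2 ≤ c ^ 2 := by linarith
      nlinarith [sq_nonneg t]
    have h2 : sin α * cos α * b ≤ a * sin α ^ 2 := by
      calc sin α * cos α * b ≤ |sin α * cos α * b| := le_abs_self _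
        _ = |sin α| * |cos α| * |b| := by rw [abs_mul, abs_mul]
        _ ≤ |sin α| * |cos α| * (a * t) := by gcongr
        _ = a * |sin α| * (t * |cos α|) := by ring
        _ ≤ a * |sin α| * |sin α| := by gcongr
        _ = a * sin α ^ 2 := by rw [← sq_abs (sin α)]; ring
    linear_combination 2 * h2 + 2 * a * hsα

/-- The open regular `n`-gon with inradius `1` centred at the origin. -/
def regularPolygon (n : ℕ) : Set (EuclideanSpace ℝ (Fin 2)) :=
  {x | ∀ j : Fin n, dirCoord (normalAngle n (j : ℕ)) x < 1}

/-- The `k`-th side of the regular `n`-gon. -/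
def polygonSide (n : ℕ) (k : Fin n) : Set (EuclideanSpace ℝ (Fin 2)) :=
  framePoint (normalAngle n (k : ℕ)) 1 '' Icc (-tan (π / n)) (tan (π / n))

/-- The triangle spanned by the origin and the `k`-th side of the regular `n`-gon. -/
def polygonSector (n : ℕ) (k : Fin n) : Set (EuclideanSpace ℝ (Fin 2)) :=
  {x | dirCoord (normalAngle n (k : ℕ)) x < 1 ∧
    |dirCoord (normalAngle n (k : ℕ) + π / 2) x| ≤
      dirCoord (normalAngle n (k : ℕ)) x * tan (π / n)}

lemma isOpen_regularPolygon (n : ℕ) : IsOpen (regularPolygon n) := by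
  simp only [regularPolygon, ofPred_forall]
  exact isOpen_iInter_of_finite fun j =>
    isOpen_lt (dirCoord _).continuous continuous_const

lemma convex_regularPolygon (n : ℕ) : Convex ℝ (regularPolygon n) := by
  simp only [regularPolygon, ofPred_forall]
  exact convex_iInter fun j => convex_halfSpace_lt (dirCoord _).isLinear 1

lemma zero_mem_regularPolygon (n : ℕ) : 0 ∈ regularPolygon n := by
  simp [regularPolygon]

lemma exists_forall_dirCoord_le {n : ℕ} (hn : 3 ≤ n) (x : EuclideanSpace ℝ (Fin 2)) :
    ∃ k : Fin n, ∀ j : Fin n,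
      dirCoord (normalAngle n (j : ℕ)) x ≤ dirCoord (normalAngle n (k : ℕ)) x :=
  haveI : Nonempty (Fin n) := ⟨⟨0, by omega⟩⟩
  Finite.exists_max _

lemma mem_polygonSector_iff {n : ℕ} (hn : 3 ≤ n) {k : Fin n} {x : EuclideanSpace ℝ (Fin 2)} :
    x ∈ polygonSector n k ↔ x ∈ regularPolygon n ∧
      ∀ j : Fin n, dirCoord (normalAngle n (j : ℕ)) x ≤ dirCoord (normalAngle n (k : ℕ)) x := by
  rw [forall_dirCoord_le_iff hn]
  constructor
  · intro h
    exact ⟨fun j => ((forall_dirCoord_le_iff hn k x).2 h.2 j).trans_lt h.1, h.2⟩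
  · intro h
    exact ⟨h.1 k, h.2⟩

lemma mem_polygonSide_iff {n : ℕ} (hn : 3 ≤ n) {k : Fin n} {x : EuclideanSpace ℝ (Fin 2)} :
    x ∈ polygonSide n k ↔ dirCoord (normalAngle n (k : ℕ)) x = 1 ∧
      ∀ j : Fin n, dirCoord (normalAngle n (j : ℕ)) x ≤ 1 := by
  have h : dirCoord (normalAngle n (k : ℕ)) x = 1 →
      ((∀ j : Fin n, dirCoord (normalAngle n (j : ℕ)) x ≤ 1) ↔
      |dirCoord (normalAngle n (k : ℕ) + π / 2) x| ≤ tan (π / n)) := by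
    intro h1
    have := forall_dirCoord_le_iff hn k x
    rwa [h1, one_mul] at this
  constructor
  · rintro ⟨s, hs, rfl⟩
    have h1 := dirCoord_framePoint (normalAngle n (k : ℕ)) 1 s
    refine ⟨h1, (h h1).2 ?_⟩
    rw [dirCoord_perp_framePoint, abs_le]
    exact hs
  · rintro ⟨h1, h2⟩
    refine ⟨dirCoord (normalAngle n (k : ℕ) + π / 2) x, abs_le.1 ((h h1).1 h2), ?_⟩
    conv_rhs => rw [← framePoint_dirCoord (normalAngle n (k : ℕ)) x, h1]

lemma regularPolygon_eq_iUnion {n : ℕ} (hn : 3 ≤ n) :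
    regularPolygon n = ⋃ k, polygonSector n k := by
  ext x
  simp only [mem_iUnion, mem_polygonSector_iff hn, exists_and_left]
  exact (and_iff_left (exists_forall_dirCoord_le hn x)).symm

lemma isBounded_regularPolygon {n : ℕ} (hn : 3 ≤ n) : IsBounded (regularPolygon n) := by
  refine (isBounded_iff_forall_norm_le).2 ⟨1 + tan (π / n), fun x hx => ?_⟩
  rw [regularPolygon_eq_iUnion hn, mem_iUnion] at hx
  obtain ⟨k, h1, h2⟩ := hx
  have ht := tan_pi_div_pos hn
  have hx := dirCoord_sq_add_sq (normalAngle n (k : ℕ)) x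
  generalize dirCoord (normalAngle n (k : ℕ)) x = a at *
  have ha : 0 ≤ a := nonneg_of_mul_nonneg_left ((abs_nonneg _).trans h2) ht
  have hb := pow_le_pow_left₀ (abs_nonneg _) (h2.trans (mul_le_of_le_one_left ht.le h1.le)) 2
  rw [sq_abs] at hb
  refine le_of_sq_le_sq ?_ (by positivity)
  nlinarith

lemma closure_regularPolygon (n : ℕ) :
    closure (regularPolygon n) = {x | ∀ j : Fin n, dirCoord (normalAngle n (j : ℕ)) x ≤ 1} := by
  apply Subset.antisymm
  · apply closure_minimal
    · exact fun x hx j => (hx j).le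
    · simp only [ofPred_forall]
      exact isClosed_iInter fun j => isClosed_le (dirCoord _).continuous continuous_const
  · intro x hx
    have hlim : Filter.Tendsto (fun r : ℝ => r • x) (nhdsWithin 1 (Iio 1)) (nhds x) := by
      have : ContinuousAt (fun r : ℝ => r • x) 1 := by fun_prop
      simpa using this.tendsto.mono_left nhdsWithin_le_nhds
    refine mem_closure_of_tendsto hlim ?_
    filter_upwards [Ioo_mem_nhdsLT zero_lt_one] with r hr j
    rw [map_smul, smul_eq_mul]
    have := hx j
    nlinarith [hr.1, hr.2]

lemma frontier_regularPolygon {n : ℕ} (hn : 3 ≤ n) :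
    frontier (regularPolygon n) = ⋃ k, polygonSide n k := by
  rw [(isOpen_regularPolygon n).frontier_eq, closure_regularPolygon]
  ext x
  simp only [mem_iUnion, mem_polygonSide_iff hn, exists_and_right, mem_sdiff, mem_ofPred_eq,
    regularPolygon, not_forall, not_lt]
  constructor
  · rintro ⟨h, k, hk⟩
    exact ⟨⟨k, (h k).antisymm hk⟩, h⟩
  · rintro ⟨⟨k, hk⟩, h⟩
    exact ⟨h, k, hk.ge⟩

lemma dirCoord_normalAngle_rotate {n : ℕ} (j k : Fin n) (x : EuclideanSpace ℝ (Fin 2)) :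
    dirCoord (normalAngle n (j : ℕ)) x =
      (1 - 2 * sin ((((j : ℕ) : ℤ) - ((k : ℕ) : ℤ) : ℤ) * (π / n)) ^ 2) *
          dirCoord (normalAngle n (k : ℕ)) x +
        2 * sin ((((j : ℕ) : ℤ) - ((k : ℕ) : ℤ) : ℤ) * (π / n)) *
          cos ((((j : ℕ) : ℤ) - ((k : ℕ) : ℤ) : ℤ) * (π / n)) *
          dirCoord (normalAngle n (k : ℕ) + π / 2) x := by
  rw [← cos_two_mul_eq_one_sub, ← sin_two_mul, ← dirCoord_add]
  congr 2
  simp only [normalAngle]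
  push_cast
  ring

lemma isClosed_polygonSide (n : ℕ) (k : Fin n) : IsClosed (polygonSide n k) :=
  (isometry_framePoint _ _).isClosedEmbedding.isClosedMap _ isClosed_Icc

lemma aedisjoint_polygonSide {n : ℕ} (hn : 3 ≤ n) :
    Pairwise (Function.onFun (AEDisjoint (μH[1])) (polygonSide n)) := by
  intro j k hjk
  have hs := sin_sub_mul_pi_div_ne_zero hjk
  have := Measure.nullSingletonClass_hausdorff (EuclideanSpace ℝ (Fin 2)) one_pos
  apply Set.Subsingleton.measure_zero
  intro x hx y hy
  have hx1 := (mem_polygonSide_iff hn).1 hx.1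
  have hx2 := (mem_polygonSide_iff hn).1 hx.2
  have hy1 := (mem_polygonSide_iff hn).1 hy.1
  have hy2 := (mem_polygonSide_iff hn).1 hy.2
  have ex := dirCoord_normalAngle_rotate j k x
  have ey := dirCoord_normalAngle_rotate j k y
  rw [← framePoint_dirCoord (normalAngle n (k : ℕ)) x,
    ← framePoint_dirCoord (normalAngle n (k : ℕ)) y]
  rw [hx1.1, hx2.1] at ex
  rw [hy1.1, hy2.1] at ey
  rw [hx2.1, hy2.1]
  congr 1
  have hx' : sin ((((j : ℕ) : ℤ) - ((k : ℕ) : ℤ) : ℤ) * (π / n)) =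
      cos ((((j : ℕ) : ℤ) - ((k : ℕ) : ℤ) : ℤ) * (π / n)) *
        dirCoord (normalAngle n (k : ℕ) + π / 2) x :=
    mul_left_cancel₀ hs (by linear_combination (1 / 2) * ex)
  have hy' : sin ((((j : ℕ) : ℤ) - ((k : ℕ) : ℤ) : ℤ) * (π / n)) =
      cos ((((j : ℕ) : ℤ) - ((k : ℕ) : ℤ) : ℤ) * (π / n)) *
        dirCoord (normalAngle n (k : ℕ) + π / 2) y :=
    mul_left_cancel₀ hs (by linear_combination (1 / 2) * ey)
  refine mul_left_cancel₀ (fun hc => hs ?_) (hx'.symm.trans hy')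
  rw [hx', hc, zero_mul]

lemma aedisjoint_polygonSector {n : ℕ} (hn : 3 ≤ n) :
    Pairwise (Function.onFun (AEDisjoint volume) (polygonSector n)) := by
  intro j k hjk
  have hs := sin_sub_mul_pi_div_ne_zero hjk
  let p : Submodule ℝ (EuclideanSpace ℝ (Fin 2)) :=
    LinearMap.ker (dirCoord (normalAngle n (j : ℕ)) - dirCoord (normalAngle n (k : ℕ))).toLinearMap
  have hp : p ≠ ⊤ := by
    intro h
    have h0 : framePoint (normalAngle n (k : ℕ)) 1 0 ∈ p := by rw [h]; trivial
    have h1 : dirCoord (normalAngle n (j : ℕ)) (framePoint (normalAngle n (k : ℕ)) 1 0) -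
        dirCoord (normalAngle n (k : ℕ)) (framePoint (normalAngle n (k : ℕ)) 1 0) = 0 := h0
    rw [dirCoord_normalAngle_rotate j k, dirCoord_framePoint, dirCoord_perp_framePoint] at h1
    exact hs (pow_eq_zero_iff two_ne_zero |>.1 (by linarith))
  refine measure_mono_null (fun x hx => ?_) (Measure.addHaar_submodule volume p hp)
  have h1 := ((mem_polygonSector_iff hn).1 hx.1).2 k
  have h2 := ((mem_polygonSector_iff hn).1 hx.2).2 j
  change dirCoord (normalAngle n (j : ℕ)) x - dirCoord (normalAngle n (k : ℕ)) x = 0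
  linarith

lemma measurableSet_polygonSector (n : ℕ) (k : Fin n) : MeasurableSet (polygonSector n k) :=
  (measurePreserving_dirCoord_prod (normalAngle n (k : ℕ))).measurable
    (measurableSet_cone (tan (π / n)))

lemma volume_polygonSector {n : ℕ} (hn : 3 ≤ n) (k : Fin n) :
    volume (polygonSector n k) = ENNReal.ofReal (tan (π / n)) := by
  rw [← volume_cone _ (tan_pi_div_pos hn)]
  exact (measurePreserving_dirCoord_prod (normalAngle n (k : ℕ))).measure_preimage
    (measurableSet_cone _).nullMeasurableSet

lemma vol_regularPolygon {n : ℕ} (hn : 3 ≤ n) :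
    vol 2 (regularPolygon n) = n * tan (π / n) := by
  have ht := tan_pi_div_pos hn
  rw [vol, regularPolygon_eq_iUnion hn, measure_iUnion₀ (aedisjoint_polygonSector hn)
    fun k => (measurableSet_polygonSector n k).nullMeasurableSet]
  simp [volume_polygonSector hn, ht.le]

lemma hausdorffMeasure_polygonSide (n : ℕ) (k : Fin n) :
    μH[1] (polygonSide n k) = ENNReal.ofReal (2 * tan (π / n)) := by
  rw [polygonSide, (isometry_framePoint _ _).hausdorffMeasure_image (Or.inl zero_le_one),
    hausdorffMeasure_real, Real.volume_Icc]
  congr 1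
  ring

lemma perim_regularPolygon {n : ℕ} (hn : 3 ≤ n) :
    perim 2 (regularPolygon n) = 2 * (n * tan (π / n)) := by
  have ht := tan_pi_div_pos hn
  have h21 : ((2 : ℕ) : ℝ) - 1 = 1 := by norm_num
  rw [perim, h21, frontier_regularPolygon hn, measure_iUnion₀ (aedisjoint_polygonSide hn)
    fun k => (isClosed_polygonSide n k).nullMeasurableSet]
  simp [hausdorffMeasure_polygonSide, ht.le]
  ring

lemma setIntegral_polygonSide {n : ℕ} (hn : 3 ≤ n) (k : Fin n) :
    ∫ x in polygonSide n k, ‖x‖ ^ 2 ∂μH[1] = 2 * (tan (π / n) + tan (π / n) ^ 3 / 3) := by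
  have ht := tan_pi_div_pos hn
  have hiso := isometry_framePoint (normalAngle n (k : ℕ)) 1
  have hsub : polygonSide n k ⊆ range (framePoint (normalAngle n (k : ℕ)) 1) :=
    image_subset_range _ _
  rw [← Measure.restrict_restrict_of_subset hsub,
    ← hiso.map_hausdorffMeasure (Or.inl zero_le_one),
    hiso.isClosedEmbedding.measurableEmbedding.setIntegral_map, polygonSide,
    preimage_image_eq _ hiso.injective, hausdorffMeasure_real]
  simp_rw [norm_framePoint_sq]
  rw [integral_Icc_eq_integral_Ioc, ← intervalIntegral.integral_of_le (by linarith)]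
  rw [intervalIntegral.integral_add (by simp) (by simp), integral_pow]
  simp
  ring

lemma bmom_regularPolygon {n : ℕ} (hn : 3 ≤ n) :
    bmom 2 (regularPolygon n) = n * (2 * (tan (π / n) + tan (π / n) ^ 3 / 3)) := by
  have h21 : ((2 : ℕ) : ℝ) - 1 = 1 := by norm_num
  rw [bmom, h21, frontier_regularPolygon hn, integral_iUnion_ae
    (fun k => (isClosed_polygonSide n k).nullMeasurableSet) (aedisjoint_polygonSide hn)]
  · simp [setIntegral_polygonSide hn]
  · refine integrableOn_finite_iUnion.2 fun k => ?_
    have ht := tan_pi_div_pos hn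
    refine Integrable.of_integral_ne_zero ?_
    rw [setIntegral_polygonSide hn]
    positivity

lemma add_cube_div_three_le_tan {x : ℝ} (h0 : 0 ≤ x) (h1 : x < π / 2) : x + x ^ 3 / 3 ≤ tan x := by
  have hcos : ∀ y ∈ Ico 0 (π / 2), cos y ≠ 0 := fun y hy =>
    (cos_pos_of_mem_Ioo ⟨by linarith [hy.1, pi_pos], hy.2⟩).ne'
  have hder : ∀ y ∈ Ico 0 (π / 2),
      HasDerivAt (fun z => tan z - (z + z ^ 3 / 3)) (1 / cos y ^ 2 - (1 + y ^ 2)) y := by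
    intro y hy
    refine (hasDerivAt_tan (hcos y hy)).sub ((hasDerivAt_id y).add ?_)
    have h3 := (hasDerivAt_pow 3 y).div_const 3
    rwa [show ((3 : ℕ) : ℝ) * y ^ (3 - 1) / 3 = y ^ 2 by push_cast; ring] at h3
  have hmono : MonotoneOn (fun z => tan z - (z + z ^ 3 / 3)) (Ico 0 (π / 2)) := by
    refine monotoneOn_of_hasDerivWithinAt_nonneg (convex_Ico _ _)
      (fun y hy => (hder y hy).continuousAt.continuousWithinAt)
      (fun y hy => (hder y (interior_subset hy)).hasDerivWithinAt) ?_
    intro y hy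
    have hy' := interior_subset hy
    have h2 := le_tan hy'.1 hy'.2
    have h3 : y ^ 2 ≤ tan y ^ 2 := pow_le_pow_left₀ hy'.1 h2 2
    have h4 := inv_one_add_tan_sq (hcos y hy')
    rw [one_div, ← h4, inv_inv]
    linarith
  have := hmono ⟨le_rfl, by linarith⟩ ⟨h0, h1⟩ h0
  simp at this
  linarith

lemma tendsto_tan_pi_div_ratio :
    Filter.Tendsto (fun n : ℕ => tan (π / n) / (π / n)) Filter.atTop (nhds 1) := by
  have h := (hasDerivAt_tan (x := 0) (by simp)).tendsto_slope
  have h0 : Filter.Tendsto (fun n : ℕ => π / (n : ℝ)) Filter.atTop (nhdsWithin 0 {0}ᶜ) := by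
    refine tendsto_nhdsWithin_iff.2 ⟨tendsto_const_div_atTop_nhds_zero_nat π, ?_⟩
    filter_upwards [Filter.eventually_gt_atTop 0] with n hn
    have : 0 < π / n := by positivity
    exact this.ne'
  have := h.comp h0
  simpa [Function.comp_def, slope_def_field] using this

/-- For `θ = π / n`, this says that the regular `n`-gon beats the disc as soon as
`tan² θ < (1 + γ / 2) θ²`. -/
lemma one_add_sq_div_three_lt {γ θ : ℝ} (hγ : 0 < γ) (h0 : 0 < θ) (h1 : θ < π / 2)
    (h : (tan θ / θ) ^ 2 < 1 + γ / 2) :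
    1 + tan θ ^ 2 / 3 < (tan θ / θ) ^ (1 + γ / 2) := by
  have ht : 1 + θ ^ 2 / 3 ≤ tan θ / θ := by
    rw [le_div_iff₀ h0]
    linarith [add_cube_div_three_le_tan h0.le h1]
  rw [div_pow, div_lt_iff₀ (by positivity)] at h
  calc 1 + tan θ ^ 2 / 3 < 1 + (1 + γ / 2) * (θ ^ 2 / 3) := by linarith
    _ ≤ (1 + θ ^ 2 / 3) ^ (1 + γ / 2) :=
      one_add_mul_self_le_rpow_one_add (by linarith [sq_nonneg θ]) (by linarith)
    _ ≤ (tan θ / θ) ^ (1 + γ / 2) := by gcongr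

/-- for every `γ > 0` there is a bounded open convex planar set (a regular
polygon with many sides) on which `W / (P^{1+γ} V^{1-γ/2})` is smaller than its value
`2^{-γ} π^{-(1+γ/2)}` on discs centered at the origin; hence discs do not minimize `λ_γ`. -/
theorem lam_gamma_disc_not_minimizer (γ : ℝ) (hγ : 0 < γ) :
    ∃ Ω : Set (EuclideanSpace ℝ (Fin 2)),
      IsBounded Ω ∧ IsOpen Ω ∧ Convex ℝ Ω ∧ (interior Ω).Nonempty ∧
      bmom 2 Ω / (perim 2 Ω ^ ((1 : ℝ) + γ) * vol 2 Ω ^ ((1 : ℝ) - γ / 2)) <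
        (2 : ℝ) ^ (-γ) * π ^ (-((1 : ℝ) + γ / 2)) := by
  have hlim := (tendsto_tan_pi_div_ratio.pow 2).eventually_lt_const
    (show (1 : ℝ) ^ 2 < 1 + γ / 2 by linarith)
  obtain ⟨n, hn, hn3⟩ := (hlim.and (Filter.eventually_ge_atTop 3)).exists
  refine ⟨regularPolygon n, isBounded_regularPolygon hn3, isOpen_regularPolygon n,
    convex_regularPolygon n, ?_, ?_⟩
  · rw [(isOpen_regularPolygon n).interior_eq]
    exact ⟨0, zero_mem_regularPolygon n⟩
  have hn0 : (0 : ℝ) < n := by exact_mod_cast (by omega : 0 < n)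
  have key := one_add_sq_div_three_lt hγ (div_pos pi_pos hn0) (pi_div_lt_pi_div_two hn3) hn
  have ht := tan_pi_div_pos hn3
  rw [bmom_regularPolygon hn3, perim_regularPolygon hn3, vol_regularPolygon hn3]
  have hratio : tan (π / n) / (π / n) = n * tan (π / n) / π := by field_simp
  rw [hratio] at key
  have hW : n * (2 * (tan (π / n) + tan (π / n) ^ 3 / 3)) =
      2 * (n * tan (π / n)) * (1 + tan (π / n) ^ 2 / 3) := by ring
  rw [hW]
  have hv : 0 < n * tan (π / n) := by positivity
  generalize (n : ℝ) * tan (π / n) = v at *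
  rw [div_rpow hv.le pi_pos.le, lt_div_iff₀ (by positivity)] at key
  have hden : (2 * v) ^ (1 + γ) * v ^ (1 - γ / 2) = 2 * v * (2 ^ γ * v ^ (1 + γ / 2)) := by
    rw [mul_rpow two_pos.le hv.le, rpow_add two_pos, rpow_one, mul_assoc, mul_assoc,
      ← rpow_add hv, show 1 + γ + (1 - γ / 2) = 1 + (1 + γ / 2) by ring,
      rpow_add hv, rpow_one]
    ring
  rw [hden, mul_div_mul_left _ _ (by positivity), rpow_neg two_pos.le, rpow_neg pi_pos.le,
    ← mul_inv, div_lt_iff₀ (by positivity), ← div_eq_inv_mul, lt_div_iff₀ (by positivity)]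
  have : (0 : ℝ) < 2 ^ γ := by positivity
  nlinarith
end
end
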